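/- Let $A_\Gamma$ be a 3-free Artin group, i.e., $m(x,y) \neq 3$ for all distinct $x,y \in X$. Then $A_\Gamma$ has preserved signed suffixes. -/

import Mathlib

/-- The alternating product `x y x y ⋯` of length `n` in the free group, starting with `x`. -/
def altProd {X : Type*} : ℕ → X → X → FreeGroup X
  | 0, _, _ => 1
  | n + 1, x, y => FreeGroup.of x * altProd n y x

/-- The Artin relations associated to a labelling `m : X → X → ℕ∞` (label `⊤` = no relation):
for each pair `x ≠ y` with finite label `k`, the relator `(xyx⋯)(yxy⋯)⁻¹` (both of length `k`). -/
def artinRels {X : Type*} (m : X → X → ℕ∞) : Set (FreeGroup X) :=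
  { r | ∃ (x y : X) (k : ℕ), x ≠ y ∧ m x y = (k : ℕ∞) ∧
      r = altProd k x y * (altProd k y x)⁻¹ }

/-- The Artin group of the labelled graph encoded by `m`. -/
abbrev ArtinGroup {X : Type*} (m : X → X → ℕ∞) : Type _ := PresentedGroup (artinRels m)

/-- The standard generators of the Artin group. -/
def artinGen {X : Type*} (m : X → X → ℕ∞) (x : X) : ArtinGroup m := PresentedGroup.of x

/-- The Artin monoid: the submonoid of the Artin group generated by the standard generators. -/
def artinMonoid {X : Type*} (m : X → X → ℕ∞) : Submonoid (ArtinGroup m) :=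
  Submonoid.closure (Set.range (artinGen m))

/-- The monoid word metric on a group `G` relative to a submonoid `M`: `monoidDist M g h` is the
least `n` such that `g⁻¹ * h` is a product of `n` elements each lying in `M` or `M⁻¹`. -/
noncomputable def monoidDist {G : Type*} [Group G] (M : Submonoid G) (g h : G) : ℕ :=
  sInf { n : ℕ | ∃ l : List G, l.length = n ∧ (∀ a ∈ l, a ∈ M ∨ a⁻¹ ∈ M) ∧ g⁻¹ * h = l.prod }

/-- A word over `X`: a list of letters `x^ε`, where `ε = true` denotes the positive letter `x`
and `ε = false` the negative letter `x⁻¹`. -/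
abbrev Word (X : Type*) := List (X × Bool)

/-- The element of `G` represented by a word over `X`, given `f : X → G`. -/
def evalWord {X G : Type*} [Group G] (f : X → G) (w : Word X) : G :=
  (w.map (fun p => if p.2 then f p.1 else (f p.1)⁻¹)).prod

/-- A word is positive if all its letters are positive. -/
def IsPosWord {X : Type*} (w : Word X) : Prop := ∀ p ∈ w, p.2 = true

/-- A word is negative if all its letters are negative. -/
def IsNegWord {X : Type*} (w : Word X) : Prop := ∀ p ∈ w, p.2 = false

/-- A word is geodesic if no strictly shorter word represents the same element of `G`. -/
def IsGeodesic {X G : Type*} [Group G] (f : X → G) (w : Word X) : Prop :=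
  ∀ v : Word X, evalWord f v = evalWord f w → w.length ≤ v.length

/-- `(u, x)` is a blocking pair if for every word `w` such that `w ++ u` is geodesic,
the word `w ++ u ++ [x]` is also geodesic. -/
def BlockingPair {X G : Type*} [Group G] (f : X → G) (u : Word X) (x : X × Bool) : Prop :=
  ∀ w : Word X, IsGeodesic f (w ++ u) → IsGeodesic f (w ++ u ++ [x])

/-- An alternating blocking sequence `(α n)` (indexed from `n = 1`; the value `α 0` is ignored):
each `α n` is nonempty, positive for odd `n` and negative for even `n`, and every letter `x`
of `α n` is immediately preceded, within `α (n-1) ++ α n` (with `α 0` read as the empty word),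
by a subword `u` such that `(u, x)` is a blocking pair. -/
def IsAltBlockingSeq {X G : Type*} [Group G] (f : X → G) (α : ℕ → Word X) : Prop :=
  (∀ n, 1 ≤ n → α n ≠ []) ∧
  (∀ n, 1 ≤ n → Odd n → IsPosWord (α n)) ∧
  (∀ n, 1 ≤ n → Even n → IsNegWord (α n)) ∧
  (∀ n, 1 ≤ n → ∀ p x s, α n = p ++ x :: s →
    ∃ u : Word X, u <:+ ((if n = 1 then ([] : Word X) else α (n - 1)) ++ p) ∧
      BlockingPair f u x)

/-- `u` is the longest positive (`ε = true`) resp. negative (`ε = false`) proper suffix of `w`. -/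
def IsLongestSignedProperSuffix {X : Type*} (ε : Bool) (w u : Word X) : Prop :=
  u <:+ w ∧ u ≠ w ∧ (∀ p ∈ u, p.2 = ε) ∧
    ∀ v : Word X, v <:+ w → v ≠ w → (∀ p ∈ v, p.2 = ε) → v.length ≤ u.length

/-- Preserved positive (`ε = true`) resp. negative (`ε = false`) suffixes: whenever `w` is a
geodesic word ending in a letter of sign `ε`, `u` is the longest proper suffix of `w` of sign `ε`,
and `a` is a generator, the element represented by `a^ε · w` admits a geodesic representative
having `u` as a suffix. -/
def PreservedSignSuffixes {X G : Type*} [Group G] (ε : Bool) (f : X → G) : Prop :=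
  ∀ (w : Word X) (y : X), IsGeodesic f w → w.getLast? = some (y, ε) →
    ∀ u : Word X, IsLongestSignedProperSuffix ε w u →
    ∀ a : X, ∃ w' : Word X, IsGeodesic f w' ∧
      evalWord f w' = evalWord f ((a, ε) :: w) ∧ u <:+ w'

/-- Preserved signed suffixes: both preserved positive and preserved negative suffixes. -/
def PreservedSignedSuffixes {X G : Type*} [Group G] (f : X → G) : Prop :=
  PreservedSignSuffixes true f ∧ PreservedSignSuffixes false f

namespace ThreeFreeArtin

section WordLength

variable {X G : Type*} [Group G]

/-- The formal inverse of a letter. -/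
def letterInv (s : X × Bool) : X × Bool := (s.1, !s.2)

/-- The group element represented by a letter. -/
def letterVal (f : X → G) (s : X × Bool) : G := if s.2 then f s.1 else (f s.1)⁻¹

@[simp] lemma letterInv_fst (s : X × Bool) : (letterInv s).1 = s.1 := rfl

@[simp] lemma letterInv_letterInv (s : X × Bool) : letterInv (letterInv s) = s := by
  simp [letterInv]

lemma letterInv_ne (s : X × Bool) : letterInv s ≠ s := by
  intro h
  have := congrArg Prod.snd h
  simp [letterInv] at this

lemma eq_or_eq_letterInv {s t : X × Bool} (h : s.1 = t.1) : s = t ∨ s = letterInv t := by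
  obtain ⟨x, b⟩ := s
  obtain ⟨y, c⟩ := t
  obtain rfl : x = y := h
  cases b <;> cases c <;> simp [letterInv]

@[simp] lemma letterVal_letterInv (f : X → G) (s : X × Bool) :
    letterVal f (letterInv s) = (letterVal f s)⁻¹ := by
  obtain ⟨x, b⟩ := s
  cases b <;> simp [letterVal, letterInv]

lemma evalWord_nil (f : X → G) : evalWord f [] = 1 := rfl

lemma evalWord_cons (f : X → G) (s : X × Bool) (w : Word X) :
    evalWord f (s :: w) = letterVal f s * evalWord f w := rfl

lemma evalWord_append (f : X → G) (v w : Word X) :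
    evalWord f (v ++ w) = evalWord f v * evalWord f w := by
  simp [evalWord]

lemma evalWord_singleton (f : X → G) (s : X × Bool) : evalWord f [s] = letterVal f s := by
  simp [evalWord_cons, evalWord_nil]

/-- The word length of a group element with respect to a family of elements. -/
noncomputable def wlen (f : X → G) (g : G) : ℕ :=
  sInf {n | ∃ w : Word X, evalWord f w = g ∧ w.length = n}

/-- A generating family all of whose members have degree one under some homomorphism to `ℤ`. -/
structure GradedGen (f : X → G) : Prop where
  gen : ∀ g, ∃ w : Word X, evalWord f w = g
  deg : ∃ σ : G →* Multiplicative ℤ, ∀ x, σ (f x) = Multiplicative.ofAdd 1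

/-- The letter `s` is a left descent of `g`. -/
def Desc (f : X → G) (g : G) (s : X × Bool) : Prop :=
  wlen f ((letterVal f s)⁻¹ * g) < wlen f g

lemma wlen_evalWord_le (f : X → G) (w : Word X) : wlen f (evalWord f w) ≤ w.length :=
  Nat.sInf_le ⟨w, rfl, rfl⟩

lemma wlen_one (f : X → G) : wlen f 1 = 0 := by
  simpa [evalWord_nil] using wlen_evalWord_le f []

lemma isGeodesic_iff {f : X → G} {w : Word X} :
    IsGeodesic f w ↔ w.length = wlen f (evalWord f w) := by
  constructor
  · intro h
    refine le_antisymm ?_ (wlen_evalWord_le f w)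
    obtain ⟨v, hv, hl⟩ := Nat.sInf_mem (s := {n | ∃ v : Word X, evalWord f v = evalWord f w ∧
      v.length = n}) ⟨_, w, rfl, rfl⟩
    exact (h v hv).trans hl.le
  · intro h v hv
    rw [h, ← hv]
    exact wlen_evalWord_le f v

variable {f : X → G} (hf : GradedGen f)
include hf

lemma exists_geodesic (g : G) : ∃ w : Word X, evalWord f w = g ∧ w.length = wlen f g := by
  obtain ⟨w, hw⟩ := hf.gen g
  exact Nat.sInf_mem (s := {n | ∃ v : Word X, evalWord f v = g ∧ v.length = n}) ⟨_, w, hw, rfl⟩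

lemma wlen_eq_zero {g : G} : wlen f g = 0 ↔ g = 1 := by
  constructor
  · intro h
    obtain ⟨w, hw, hl⟩ := exists_geodesic hf g
    rw [h, List.length_eq_zero_iff] at hl
    rw [← hw, hl, evalWord_nil]
  · rintro rfl
    exact wlen_one f

lemma wlen_mul_le (g h : G) : wlen f (g * h) ≤ wlen f g + wlen f h := by
  obtain ⟨v, hv, hvl⟩ := exists_geodesic hf g
  obtain ⟨w, hw, hwl⟩ := exists_geodesic hf h
  have := wlen_evalWord_le f (v ++ w)
  rw [evalWord_append, hv, hw, List.length_append, hvl, hwl] at this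
  exact this

lemma wlen_inv_le (g : G) : wlen f g⁻¹ ≤ wlen f g := by
  obtain ⟨v, hv, hvl⟩ := exists_geodesic hf g
  have key : ∀ w : Word X, evalWord f (w.map letterInv).reverse = (evalWord f w)⁻¹ := by
    intro w
    induction w with
    | nil => simp [evalWord_nil]
    | cons s w ih =>
      simp [evalWord_append, ih, evalWord_cons, evalWord_nil]
  have := wlen_evalWord_le f (v.map letterInv).reverse
  rw [key, hv] at this
  simpa [hvl] using this

lemma wlen_inv (g : G) : wlen f g⁻¹ = wlen f g :=
  le_antisymm (wlen_inv_le hf g) (by simpa using wlen_inv_le hf g⁻¹)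

omit hf in
lemma wlen_letterVal_le (f : X → G) (s : X × Bool) : wlen f (letterVal f s) ≤ 1 := by
  simpa [evalWord_singleton] using wlen_evalWord_le f [s]

lemma exists_degree : ∃ σ : G →* Multiplicative ℤ, (∀ x, σ (f x) = Multiplicative.ofAdd 1) ∧
    (∀ g, (σ g).toAdd ≤ wlen f g) ∧ ∀ g, (σ g).toAdd % 2 = (wlen f g : ℤ) % 2 := by
  obtain ⟨σ, hσ⟩ := hf.deg
  have key : ∀ w : Word X, (σ (evalWord f w)).toAdd ≤ w.length ∧
      (σ (evalWord f w)).toAdd % 2 = (w.length : ℤ) % 2 := by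
    intro w
    induction w with
    | nil => simp [evalWord_nil]
    | cons s w ih =>
      obtain ⟨x, b⟩ := s
      rw [evalWord_cons, map_mul, toAdd_mul]
      cases b <;> simp [letterVal, hσ] <;> omega
  refine ⟨σ, hσ, fun g => ?_, fun g => ?_⟩ <;> obtain ⟨w, hw, hl⟩ := exists_geodesic hf g
  · rw [← hw, ← hl.trans (congrArg _ hw.symm)]; exact (key w).1
  · rw [← hw, ← hl.trans (congrArg _ hw.symm)]; exact (key w).2

lemma wlen_letter_mul (s : X × Bool) (g : G) :
    wlen f (letterVal f s * g) = wlen f g + 1 ∨ wlen f g = wlen f (letterVal f s * g) + 1 := by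
  obtain ⟨σ, hσ, -, hp⟩ := exists_degree hf
  have h1 := wlen_mul_le hf (letterVal f s) g
  have h2 := wlen_mul_le hf (letterVal f (letterInv s)) (letterVal f s * g)
  rw [letterVal_letterInv, inv_mul_cancel_left, ← letterVal_letterInv] at h2
  have h3 := wlen_letterVal_le f s
  have h4 := wlen_letterVal_le f (letterInv s)
  have h5 := hp (letterVal f s * g)
  have h6 := hp g
  rw [map_mul, toAdd_mul] at h5
  have h7 : (σ (letterVal f s)).toAdd = 1 ∨ (σ (letterVal f s)).toAdd = -1 := by
    obtain ⟨x, b⟩ := s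
    cases b <;> simp [letterVal, hσ]
  omega

lemma wlen_mul_letter (s : X × Bool) (g : G) :
    wlen f (g * letterVal f s) = wlen f g + 1 ∨ wlen f g = wlen f (g * letterVal f s) + 1 := by
  have := wlen_letter_mul hf (letterInv s) g⁻¹
  rwa [letterVal_letterInv, ← mul_inv_rev, wlen_inv hf, wlen_inv hf] at this

lemma desc_iff {s : X × Bool} {g : G} :
    Desc f g s ↔ wlen f g = wlen f ((letterVal f s)⁻¹ * g) + 1 := by
  have := wlen_letter_mul hf (letterInv s) g
  rw [letterVal_letterInv] at this
  unfold Desc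
  omega

lemma not_desc_iff {s : X × Bool} {g : G} :
    ¬ Desc f g s ↔ wlen f ((letterVal f s)⁻¹ * g) = wlen f g + 1 := by
  have := wlen_letter_mul hf (letterInv s) g
  rw [letterVal_letterInv] at this
  unfold Desc
  omega

lemma not_desc_letterInv_iff {s : X × Bool} {g : G} :
    ¬ Desc f g (letterInv s) ↔ wlen f (letterVal f s * g) = wlen f g + 1 := by
  rw [not_desc_iff hf, letterVal_letterInv, inv_inv]

lemma exists_desc {g : G} (hg : g ≠ 1) : ∃ s, Desc f g s := by
  obtain ⟨w, hw, hl⟩ := exists_geodesic hf g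
  cases w with
  | nil => exact absurd hw.symm hg
  | cons s w =>
    refine ⟨s, ?_⟩
    have := wlen_evalWord_le f w
    rw [evalWord_cons] at hw
    rw [Desc, ← hl, ← hw, inv_mul_cancel_left]
    simpa [Nat.lt_succ_iff] using this

lemma wlen_letterVal (s : X × Bool) : wlen f (letterVal f s) = 1 := by
  have := wlen_letter_mul hf s 1
  rw [mul_one, wlen_one] at this
  omega

omit hf in
lemma isGeodesic_tail {s : X × Bool} {w : Word X} (h : IsGeodesic f (s :: w)) :
    IsGeodesic f w := by
  intro v hv
  have := h (s :: v) (by rw [evalWord_cons, evalWord_cons, hv])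
  simpa using this

end WordLength

end ThreeFreeArtin

namespace ThreeFreeArtin

section Presentation

/-- The alternating product `a b a ⋯` of length `n`, starting with `a`. -/
def altMul {M : Type*} [Monoid M] : ℕ → M → M → M
  | 0, _, _ => 1
  | n + 1, a, b => a * altMul n b a

lemma map_altMul {M N : Type*} [Monoid M] [Monoid N] (φ : M →* N) (n : ℕ) (a b : M) :
    φ (altMul n a b) = altMul n (φ a) (φ b) := by
  induction n generalizing a b with
  | zero => simp [altMul]
  | succ n ih => simp [altMul, ih]

lemma altMul_eq_altProd {X : Type*} (n : ℕ) (x y : X) :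
    altMul n (FreeGroup.of x) (FreeGroup.of y) = altProd n x y := by
  induction n generalizing x y with
  | zero => rfl
  | succ n ih => simp [altMul, altProd, ih]

variable {X : Type*} {m : X → X → ℕ∞}

lemma altMul_artinGen {x y : X} (hxy : x ≠ y) {k : ℕ} (hm : m x y = k) :
    altMul k (artinGen m x) (artinGen m y) = altMul k (artinGen m y) (artinGen m x) := by
  have h : PresentedGroup.mk (artinRels m) (altProd k x y * (altProd k y x)⁻¹) = 1 :=
    PresentedGroup.one_of_mem ⟨x, y, k, hxy, hm, rfl⟩
  rw [map_mul, map_inv, mul_inv_eq_one, ← altMul_eq_altProd, ← altMul_eq_altProd,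
    map_altMul, map_altMul] at h
  exact h

/-- The universal property of an Artin group. -/
noncomputable def artinLift {H : Type*} [Group H] (φ : X → H)
    (h : ∀ x y, x ≠ y → ∀ k : ℕ, m x y = k → altMul k (φ x) (φ y) = altMul k (φ y) (φ x)) :
    ArtinGroup m →* H :=
  PresentedGroup.toGroup (f := φ) (by
    rintro r ⟨x, y, k, hxy, hm, rfl⟩
    rw [map_mul, map_inv, mul_inv_eq_one, ← altMul_eq_altProd, ← altMul_eq_altProd,
      map_altMul, map_altMul]
    simpa using h x y hxy k hm)

@[simp] lemma artinLift_gen {H : Type*} [Group H] (φ : X → H)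
    (h : ∀ x y, x ≠ y → ∀ k : ℕ, m x y = k → altMul k (φ x) (φ y) = altMul k (φ y) (φ x)) (x : X) :
    artinLift φ h (artinGen m x) = φ x :=
  PresentedGroup.toGroup.of _

lemma map_letterVal {G H : Type*} [Group G] [Group H] (φ : G →* H) (f : X → G)
    (s : X × Bool) : φ (letterVal f s) = letterVal (φ ∘ f) s := by
  obtain ⟨x, b⟩ := s
  cases b <;> simp [letterVal]

lemma gradedGen_artinGen (m : X → X → ℕ∞) : GradedGen (artinGen m) where
  gen g := by
    obtain ⟨w, rfl⟩ := PresentedGroup.mk_surjective (artinRels m) g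
    induction w using FreeGroup.induction_on with
    | C1 => exact ⟨[], by simp [evalWord_nil]⟩
    | of x => exact ⟨[(x, true)], by rw [evalWord_singleton]; simp [letterVal]; rfl⟩
    | inv_of x _ => exact ⟨[(x, false)], by rw [evalWord_singleton]; simp [letterVal]; rfl⟩
    | mul a b ha hb =>
      obtain ⟨v, hv⟩ := ha
      obtain ⟨w, hw⟩ := hb
      exact ⟨v ++ w, by rw [evalWord_append, hv, hw, map_mul]⟩
  deg := ⟨artinLift (fun _ => Multiplicative.ofAdd 1) (fun _ _ _ _ _ => rfl), fun x => by simp⟩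

end Presentation

/-- The dihedral Artin group with label `k`. -/
abbrev Dih (k : ℕ) : Type := ArtinGroup (fun _ _ : Bool => (k : ℕ∞))

/-- The standard generators of the dihedral Artin group. -/
noncomputable abbrev dgen (k : ℕ) : Bool → Dih k := artinGen _

/-- Normal forms of elements of a dihedral Artin group: a power of the Garside element, together
with a list of lengths of alternating positive words and the first letter of the first one. -/
@[ext] structure DState where
  κ : ℤ
  f : Bool
  l : List ℕ

namespace DState

/-- The flag in front of an empty list is normalised to `true`. -/
def canon (f : Bool) : List ℕ → Bool
  | [] => true
  | _ :: _ => f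

/-- Left multiplication of a normal form by a positive generator. -/
def push (k : ℕ) (β : Bool) : DState → DState
  | ⟨κ, _, []⟩ => ⟨κ, β, [1]⟩
  | ⟨κ, f, i :: t⟩ =>
    if f = β then ⟨κ, β, 1 :: i :: t⟩
    else if i + 1 = k then ⟨κ + 1, canon f t, t⟩ else ⟨κ, β, (i + 1) :: t⟩

/-- Left multiplication of a normal form by the inverse of a positive generator. -/
def pull (k : ℕ) (β : Bool) : DState → DState
  | ⟨κ, _, []⟩ => ⟨κ - 1, !β, [k - 1]⟩
  | ⟨κ, f, i :: t⟩ =>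
    if f = β then if i = 1 then ⟨κ, canon β t, t⟩ else ⟨κ, !β, (i - 1) :: t⟩
    else ⟨κ - 1, f, (k - 1) :: i :: t⟩

/-- The validity condition on normal forms. -/
def Valid (k : ℕ) (s : DState) : Prop :=
  (∀ i ∈ s.l, 1 ≤ i ∧ i < k) ∧ canon s.f s.l = s.f

lemma canon_cons (f : Bool) (i : ℕ) (t : List ℕ) : canon f (i :: t) = f := rfl
lemma canon_canon (f : Bool) (t : List ℕ) : canon (canon f t) t = canon f t := by
  cases t <;> rfl

variable {k : ℕ}

lemma Valid.push (hk : 2 ≤ k) (β : Bool) {s : DState} (h : s.Valid k) : (s.push k β).Valid k := by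
  obtain ⟨κ, f, l⟩ := s
  obtain ⟨h1, h2⟩ := h
  cases l with
  | nil => simp [DState.push, Valid, canon]; omega
  | cons i t =>
    simp only [List.mem_cons, forall_eq_or_imp] at h1
    obtain ⟨h1, h3⟩ := h1
    simp only [DState.push]
    split_ifs
    · refine ⟨?_, rfl⟩
      simp only [List.mem_cons, forall_eq_or_imp]
      exact ⟨by omega, h1, h3⟩
    · exact ⟨h3, canon_canon _ _⟩
    · refine ⟨?_, rfl⟩
      simp only [List.mem_cons, forall_eq_or_imp]
      exact ⟨by omega, h3⟩

lemma Valid.pull (hk : 2 ≤ k) (β : Bool) {s : DState} (h : s.Valid k) : (s.pull k β).Valid k := by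
  obtain ⟨κ, f, l⟩ := s
  obtain ⟨h1, h2⟩ := h
  cases l with
  | nil => simp [DState.pull, Valid, canon]; omega
  | cons i t =>
    simp only [List.mem_cons, forall_eq_or_imp] at h1
    obtain ⟨h1, h3⟩ := h1
    simp only [DState.pull]
    split_ifs
    · exact ⟨h3, canon_canon _ _⟩
    · refine ⟨?_, rfl⟩
      simp only [List.mem_cons, forall_eq_or_imp]
      exact ⟨by omega, h3⟩
    · refine ⟨?_, rfl⟩
      simp only [List.mem_cons, forall_eq_or_imp]
      exact ⟨by omega, h1, h3⟩

lemma pull_push (hk : 2 ≤ k) (β : Bool) {s : DState} (h : s.Valid k) :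
    (s.push k β).pull k β = s := by
  obtain ⟨κ, f, l⟩ := s
  obtain ⟨h1, h2⟩ := h
  cases l with
  | nil => simpa [push, pull, canon] using h2
  | cons i t =>
    simp only [List.mem_cons, forall_eq_or_imp] at h1
    obtain ⟨h1, h3⟩ := h1
    simp only [push]
    split_ifs with hf hi
    · simp [pull, canon, hf]
    · have hf' : f = !β := by revert hf; cases f <;> cases β <;> simp
      have hi' : i = k - 1 := by omega
      cases t with
      | nil => simp [pull, hf', hi']
      | cons j t => simp [pull, canon, hf', hi']
    · have hf' : f = !β := by revert hf; cases f <;> cases β <;> simp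
      have : ¬ i = 0 := by omega
      simp [pull, hf', this]

lemma push_pull (hk : 2 ≤ k) (β : Bool) {s : DState} (h : s.Valid k) :
    (s.pull k β).push k β = s := by
  obtain ⟨κ, f, l⟩ := s
  obtain ⟨h1, h2⟩ := h
  have hk' : k - 1 + 1 = k := by omega
  cases l with
  | nil => simpa [push, pull, hk', canon] using h2
  | cons i t =>
    simp only [List.mem_cons, forall_eq_or_imp] at h1
    obtain ⟨h1, h3⟩ := h1
    simp only [pull]
    split_ifs with hf hi
    · cases t with
      | nil => simp [push, hf, hi]
      | cons j t => simp [push, canon, hf, hi]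
    · have : i - 1 + 1 = i := by omega
      have h4 : i ≠ k := by omega
      simp [push, this, h4, hf]
    · simp [push, hf, hk', canon]

/-- The iterated action of an alternating word whose rightmost letter is `γ`. -/
def pushes (k : ℕ) (γ : Bool) (s : DState) : ℕ → DState
  | 0 => s
  | n + 1 => (pushes k γ s n).push k (xor γ n.bodd)

lemma pushes_add (γ : Bool) (s : DState) (a b : ℕ) :
    pushes k γ s (a + b) = pushes k (xor γ a.bodd) (pushes k γ s a) b := by
  induction b with
  | zero => rfl
  | succ b ih =>
    rw [← add_assoc, pushes, ih, pushes]
    simp [Nat.bodd_add]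

lemma pushes_nil (γ : Bool) (κ : ℤ) (f : Bool) (n : ℕ) (hn : n + 1 < k) :
    pushes k γ ⟨κ, f, []⟩ (n + 1) = ⟨κ, xor γ n.bodd, [n + 1]⟩ := by
  induction n with
  | zero => simp [pushes, push]
  | succ n ih =>
    rw [pushes, ih (by omega)]
    have : n + 1 + 1 ≠ k := by omega
    simp [push, this]

lemma pushes_same (γ : Bool) (κ : ℤ) (i : ℕ) (t : List ℕ) (n : ℕ) (hn : n + 1 < k) :
    pushes k γ ⟨κ, γ, i :: t⟩ (n + 1) = ⟨κ, xor γ n.bodd, (n + 1) :: i :: t⟩ := by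
  induction n with
  | zero => simp [pushes, push]
  | succ n ih =>
    rw [pushes, ih (by omega)]
    have : n + 1 + 1 ≠ k := by omega
    simp [push, this]

lemma pushes_diff (γ : Bool) (κ : ℤ) (i : ℕ) (t : List ℕ) (n : ℕ) (hn : i + n < k) :
    pushes k γ ⟨κ, !γ, i :: t⟩ n = ⟨κ, xor (!γ) n.bodd, (i + n) :: t⟩ := by
  induction n with
  | zero => simp [pushes]
  | succ n ih =>
    rw [pushes, ih (by omega)]
    have : i + (n + 1) ≠ k := by omega
    cases γ <;> cases h : n.bodd <;> simp [push, this, h, add_assoc]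

lemma pushes_full (hk : 2 ≤ k) (γ : Bool) {s : DState} (h : s.Valid k) :
    pushes k γ s k = ⟨s.κ + 1, canon (xor s.f k.bodd) s.l, s.l⟩ := by
  obtain ⟨κ, f, l⟩ := s
  obtain ⟨n, rfl⟩ : ∃ n, k = n + 1 + 1 := ⟨k - 2, by omega⟩
  obtain ⟨h1, h2⟩ := h
  cases l with
  | nil =>
    rw [pushes, pushes_nil _ _ _ _ (by omega)]
    cases γ <;> cases h : n.bodd <;> simp [push, h, canon]
  | cons i t =>
    by_cases hf : f = γ
    · subst hf
      rw [pushes, pushes_same _ _ _ _ _ (by omega)]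
      cases f <;> cases h : n.bodd <;> simp [push, h, canon]
    · obtain rfl : f = !γ := by revert hf; cases f <;> cases γ <;> simp
      simp only [List.mem_cons, forall_eq_or_imp] at h1
      obtain ⟨h1, h3⟩ := h1
      obtain ⟨i, rfl⟩ : ∃ j, i = j + 1 := ⟨i - 1, by omega⟩
      obtain ⟨c, rfl⟩ : ∃ c, n = i + c := ⟨n - i, by omega⟩
      have e : i + c + 1 + 1 = (c + 1) + (i + 1) := by omega
      have e2 : pushes (i + c + 1 + 1) γ ⟨κ, !γ, (i + 1) :: t⟩ (c + 1) =
          ⟨κ + 1, canon (γ ^^ (c + 1).bodd) t, t⟩ := by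
        rw [pushes, pushes_diff _ _ _ _ _ (by omega)]
        have : i + 1 + c + 1 = i + c + 1 + 1 := by omega
        cases γ <;> cases h : c.bodd <;> simp [push, h, this]
      conv_lhs => rw [e, pushes_add, ← e]
      rw [e2]
      cases t with
      | nil =>
        rw [pushes_nil _ _ _ _ (by omega)]
        simp [canon]
        cases γ <;> cases h : c.bodd <;> cases h' : i.bodd <;> simp_all
      | cons j t =>
        rw [canon_cons, pushes_same _ _ _ _ _ (by omega)]
        simp [canon]
        cases γ <;> cases h : c.bodd <;> cases h' : i.bodd <;> simp_all

end DState

end ThreeFreeArtin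

namespace ThreeFreeArtin

namespace DState

variable {k : ℕ}

/-- The action of a letter on normal forms. -/
def move (k : ℕ) (s : Bool × Bool) (x : DState) : DState :=
  if s.2 then x.push k s.1 else x.pull k s.1

/-- The coordinate of a normal form at level `j`. -/
def vec (x : DState) (j : ℕ) : ℤ := x.κ + (x.l.countP (j < ·) : ℕ)

/-- The level modified by `push`. -/
def pos (β : Bool) (x : DState) : ℕ :=
  match x.l with
  | [] => 0
  | i :: _ => if x.f = β then 0 else i

/-- The level modified by `pull`. -/
def posInv (k : ℕ) (β : Bool) (x : DState) : ℕ :=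
  match x.l with
  | [] => k - 1
  | i :: _ => if x.f = β then i - 1 else k - 1

lemma pos_lt (hk : 2 ≤ k) (β : Bool) {x : DState} (h : x.Valid k) : x.pos β < k := by
  obtain ⟨κ, f, l⟩ := x
  obtain ⟨h1, h2⟩ := h
  cases l with
  | nil => simp [pos]; omega
  | cons i t =>
    have := h1 i (by simp)
    simp only [pos]
    split_ifs <;> omega

lemma posInv_lt (hk : 2 ≤ k) (β : Bool) {x : DState} (h : x.Valid k) : x.posInv k β < k := by
  obtain ⟨κ, f, l⟩ := x
  obtain ⟨h1, h2⟩ := h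
  cases l with
  | nil => simp [posInv]; omega
  | cons i t =>
    have := h1 i (by simp)
    simp only [posInv]
    split_ifs <;> omega

lemma vec_push (_hk : 2 ≤ k) (β : Bool) {x : DState} (h : x.Valid k) {j : ℕ} (hj : j < k) :
    (x.push k β).vec j = x.vec j + if j = x.pos β then 1 else 0 := by
  obtain ⟨κ, f, l⟩ := x
  obtain ⟨h1, h2⟩ := h
  cases l with
  | nil =>
    simp [push, pos, vec, List.countP_cons]
    split_ifs <;> simp_all
  | cons i t =>
    have := h1 i (by simp)
    simp only [push, pos, vec]
    split_ifs <;> simp_all [List.countP_cons] <;> (try split_ifs) <;> omega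

lemma vec_pull (hk : 2 ≤ k) (β : Bool) {x : DState} (h : x.Valid k) {j : ℕ} (hj : j < k) :
    (x.pull k β).vec j = x.vec j - if j = x.posInv k β then 1 else 0 := by
  obtain ⟨κ, f, l⟩ := x
  obtain ⟨h1, h2⟩ := h
  cases l with
  | nil =>
    simp only [pull, posInv, vec, List.countP_cons]
    simp
    split_ifs <;> omega
  | cons i t =>
    have := h1 i (by simp)
    simp only [pull, posInv, vec]
    split_ifs <;> simp_all [List.countP_cons] <;> (try split_ifs) <;> omega

lemma Valid.move (hk : 2 ≤ k) (s : Bool × Bool) {x : DState} (h : x.Valid k) :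
    (x.move k s).Valid k := by
  unfold DState.move
  split_ifs
  exacts [h.push hk _, h.pull hk _]

/-- The length of a normal form. -/
def len (k : ℕ) (x : DState) : ℕ := ∑ j ∈ Finset.range k, (x.vec j).natAbs

lemma sum_natAbs_update {k p : ℕ} (hp : p < k) (a b : ℕ → ℤ) (h : ∀ j < k, j ≠ p → b j = a j) :
    ((∑ j ∈ Finset.range k, (b j).natAbs : ℕ) : ℤ) =
      (∑ j ∈ Finset.range k, (a j).natAbs : ℕ) + |b p| - |a p| := by
  have hp' : p ∈ Finset.range k := by simpa using hp
  rw [← Finset.add_sum_erase _ _ hp', ← Finset.add_sum_erase _ _ hp']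
  have : ∑ j ∈ (Finset.range k).erase p, (b j).natAbs =
      ∑ j ∈ (Finset.range k).erase p, (a j).natAbs := by
    refine Finset.sum_congr rfl fun j hj => ?_
    simp only [Finset.mem_erase, Finset.mem_range] at hj
    rw [h j hj.2 hj.1]
  rw [this]
  push_cast
  ring

lemma len_push (hk : 2 ≤ k) (β : Bool) {x : DState} (h : x.Valid k) :
    ((x.push k β).len k : ℤ) = x.len k + if 0 ≤ x.vec (x.pos β) then 1 else -1 := by
  have hp := pos_lt hk β h
  unfold len
  rw [sum_natAbs_update hp x.vec _ fun j hj hne => by rw [vec_push hk β h hj, if_neg hne, add_zero],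
    vec_push hk β h hp, if_pos rfl]
  split_ifs with h0
  · rw [abs_of_nonneg h0, abs_of_nonneg (by omega)]; ring
  · rw [abs_of_nonpos (by omega), abs_of_neg (by omega)]; ring

lemma len_pull (hk : 2 ≤ k) (β : Bool) {x : DState} (h : x.Valid k) :
    ((x.pull k β).len k : ℤ) = x.len k + if 0 < x.vec (x.posInv k β) then -1 else 1 := by
  have hp := posInv_lt hk β h
  unfold len
  rw [sum_natAbs_update hp x.vec _ fun j hj hne => by rw [vec_pull hk β h hj, if_neg hne, sub_zero],
    vec_pull hk β h hp, if_pos rfl]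
  split_ifs with h0
  · rw [abs_of_pos h0, abs_of_nonneg (by omega)]; ring
  · rw [abs_of_neg (by omega), abs_of_nonpos (by omega)]; ring

/-- The initial normal form. -/
def base : DState := ⟨0, true, []⟩

lemma valid_base : base.Valid k := by simp [base, Valid, canon]

lemma len_base : base.len k = 0 := by simp [len, base, vec]

lemma exists_len_move_lt (hk : 2 ≤ k) {x : DState} (h : x.Valid k) (hx : x ≠ base) :
    ∃ s, (x.move k s).len k < x.len k := by
  have h4 := fun β => len_push hk β h
  have h5 := fun β => len_pull hk β h
  obtain ⟨κ, f, l⟩ := x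
  have hh := h
  obtain ⟨h1, h2⟩ := h
  have down : ∀ β, 0 < (DState.mk κ f l).vec ((DState.mk κ f l).posInv k β) →
      ∃ s, ((DState.mk κ f l).move k s).len k < (DState.mk κ f l).len k := by
    intro β h0
    refine ⟨(β, false), ?_⟩
    have := h5 β
    rw [if_pos h0] at this
    simp only [move, Bool.false_eq_true, if_false]
    omega
  have up : ∀ β, (DState.mk κ f l).vec ((DState.mk κ f l).pos β) < 0 →
      ∃ s, ((DState.mk κ f l).move k s).len k < (DState.mk κ f l).len k := by
    intro β h0
    refine ⟨(β, true), ?_⟩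
    have := h4 β
    rw [if_neg (by omega)] at this
    simp only [move, if_true]
    omega
  cases l with
  | nil =>
    have hκ : κ ≠ 0 := by
      rintro rfl
      apply hx
      simp only [canon] at h2
      simp [base, ← h2]
    rcases lt_or_gt_of_ne hκ with h0 | h0
    · exact up true (by simpa [vec] using h0)
    · exact down true (by simpa [vec] using h0)
  | cons i t =>
    have hi := h1 i (by simp)
    by_cases h0 : 0 < (DState.mk κ f (i :: t)).vec (i - 1)
    · exact down f (by simpa [posInv] using h0)
    · refine up (!f) ?_
      simp only [pos, vec, List.countP_cons] at h0 ⊢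
      have h6 : List.countP (fun x => decide (i < x)) t ≤
          List.countP (fun x => decide (i - 1 < x)) t :=
        List.countP_mono_left (by simp; omega)
      have h7 : i - 1 < i := by omega
      simp [h7] at h0 ⊢
      omega

end DState

section Action

open DState

variable {k : ℕ} (hk : 2 ≤ k)

/-- The permutation of the valid normal forms induced by a generator. -/
def dperm (β : Bool) : Equiv.Perm {s : DState // s.Valid k} where
  toFun s := ⟨s.1.push k β, s.2.push hk β⟩
  invFun s := ⟨s.1.pull k β, s.2.pull hk β⟩
  left_inv s := Subtype.ext (pull_push hk β s.2)
  right_inv s := Subtype.ext (push_pull hk β s.2)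

lemma altMul_dperm (γ : Bool) (n : ℕ) (s : {s : DState // s.Valid k}) :
    (altMul n (dperm hk γ) (dperm hk (!γ)) s).1 = pushes k (xor (!γ) n.bodd) s.1 n := by
  induction n generalizing γ with
  | zero => rfl
  | succ n ih =>
    have h1 := ih (!γ)
    rw [Bool.not_not] at h1
    have h2 : ((!γ) ^^ (n + 1).bodd) = (γ ^^ n.bodd) := by
      cases γ <;> cases h : n.bodd <;> simp [h]
    rw [altMul, Equiv.Perm.mul_apply, pushes, h2, ← h1, dperm]
    simp

/-- The action of a dihedral Artin group on the valid normal forms. -/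
noncomputable def dact : Dih k →* Equiv.Perm {s : DState // s.Valid k} :=
  artinLift (dperm hk) (by
    intro x y hxy n hn
    obtain rfl : k = n := by exact_mod_cast hn
    obtain rfl : y = !x := by revert hxy; cases x <;> cases y <;> simp
    ext1 s
    apply Subtype.ext
    have h1 := altMul_dperm hk x k s
    have h2 := altMul_dperm hk (!x) k s
    rw [Bool.not_not] at h2
    rw [h1, h2, pushes_full hk _ s.2, pushes_full hk _ s.2])

/-- The normal form of an element of a dihedral Artin group. -/
noncomputable def dst (g : Dih k) : DState := (dact hk g ⟨base, valid_base⟩).1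

lemma valid_dst (g : Dih k) : (dst hk g).Valid k := (dact hk g ⟨base, valid_base⟩).2

lemma dst_one : dst hk 1 = base := by simp [dst]

lemma dact_letterVal (s : Bool × Bool) (x : {s : DState // s.Valid k}) :
    (dact hk (letterVal (dgen k) s) x).1 = x.1.move k s := by
  rw [map_letterVal]
  have : (⇑(dact hk) ∘ dgen k) = dperm hk := by
    funext β
    simp [dact]
  rw [this]
  obtain ⟨β, b⟩ := s
  cases b
  · simp [letterVal, move, dperm]
  · simp [letterVal, move, dperm]

lemma dst_letterVal_mul (s : Bool × Bool) (g : Dih k) :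
    dst hk (letterVal (dgen k) s * g) = (dst hk g).move k s := by
  unfold dst
  rw [map_mul, Equiv.Perm.mul_apply, dact_letterVal]

lemma altMul_succ_right {M : Type*} [Monoid M] (x : Bool → M) (n : ℕ) (f : Bool) :
    altMul (n + 1) (x f) (x !f) = altMul n (x f) (x !f) * x (f ^^ n.bodd) := by
  induction n generalizing f with
  | zero => simp [altMul]
  | succ n ih =>
    have h1 := ih (!f)
    rw [Bool.not_not] at h1
    rw [altMul, h1, ← mul_assoc]
    conv_rhs => rw [altMul]
    congr 2
    cases f <;> cases h : n.bodd <;> simp [h]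

/-- The Garside element of a dihedral Artin group. -/
noncomputable def garside (k : ℕ) : Dih k := altMul k (dgen k true) (dgen k false)

lemma altMul_eq_garside (f : Bool) : altMul k (dgen k f) (dgen k !f) = garside k := by
  cases f
  · exact altMul_artinGen (m := fun _ _ : Bool => (k : ℕ∞)) (by simp) rfl
  · rfl

lemma dgen_mul_garside (f : Bool) : garside k * dgen k (f ^^ k.bodd) = dgen k f * garside k := by
  rw [← altMul_eq_garside f, ← altMul_succ_right, altMul]
  have := altMul_eq_garside (k := k) (!f)
  rw [Bool.not_not] at this
  rw [this, altMul_eq_garside]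

lemma garside_mul_altMul (n : ℕ) (f : Bool) :
    garside k * altMul n (dgen k (f ^^ k.bodd)) (dgen k !(f ^^ k.bodd)) =
      altMul n (dgen k f) (dgen k !f) * garside k := by
  induction n generalizing f with
  | zero => simp [altMul]
  | succ n ih =>
    have h1 := ih (!f)
    rw [Bool.not_not] at h1
    rw [altMul, altMul, ← mul_assoc, dgen_mul_garside, mul_assoc, mul_assoc, ← h1]
    congr 3 <;> simp

/-- The product of the alternating words of prescribed lengths. -/
noncomputable def evl (k : ℕ) : Bool → List ℕ → Dih k
  | _, [] => 1
  | f, i :: t => altMul i (dgen k f) (dgen k !f) * evl k ((!f) ^^ i.bodd) t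

lemma garside_mul_evl (f : Bool) (l : List ℕ) :
    garside k * evl k (f ^^ k.bodd) l = evl k f l * garside k := by
  induction l generalizing f with
  | nil => simp [evl]
  | cons i t ih =>
    rw [evl, evl, ← mul_assoc, garside_mul_altMul, mul_assoc, mul_assoc, ← ih]
    congr 3
    cases f <;> cases k.bodd <;> cases i.bodd <;> rfl

/-- The group element represented by a normal form. -/
noncomputable def evst (k : ℕ) (s : DState) : Dih k := evl k s.f s.l * garside k ^ s.κ

lemma evl_canon (f : Bool) (t : List ℕ) : evl k (canon f t) t = evl k f t := by
  cases t <;> rfl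

omit hk in
lemma evst_push (β : Bool) {s : DState} (h : s.Valid k) :
    evst k (s.push k β) = dgen k β * evst k s := by
  obtain ⟨κ, f, l⟩ := s
  obtain ⟨h1, h2⟩ := h
  cases l with
  | nil => simp [push, evst, evl, altMul]
  | cons i t =>
    have hi := h1 i (by simp)
    simp only [push]
    split_ifs with hf hi'
    · simp [evst, evl, altMul, hf, mul_assoc]
    · obtain rfl : f = !β := by revert hf; cases f <;> cases β <;> simp
      have h3 : dgen k β * altMul i (dgen k !β) (dgen k β) = garside k := by
        rw [← altMul_eq_garside β, ← hi', altMul]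
      simp only [evst, evl, evl_canon, Bool.not_not]
      rw [← mul_assoc, ← mul_assoc, h3]
      have h4 : (β ^^ i.bodd) = ((!β) ^^ k.bodd) := by
        rw [← hi', Nat.bodd_succ]; cases β <;> cases i.bodd <;> rfl
      rw [h4, garside_mul_evl, mul_assoc, ← zpow_one_add, add_comm]
    · obtain rfl : f = !β := by revert hf; cases f <;> cases β <;> simp
      simp only [evst, evl, Bool.not_not]
      rw [altMul, Nat.bodd_succ, ← mul_assoc, ← mul_assoc]
      congr 3
      cases β <;> cases i.bodd <;> rfl

include hk in
lemma evst_move (s : Bool × Bool) {x : DState} (h : x.Valid k) :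
    evst k (x.move k s) = letterVal (dgen k) s * evst k x := by
  obtain ⟨β, b⟩ := s
  cases b
  · have := evst_push β (h.pull hk β)
    rw [push_pull hk β h] at this
    simp [move, letterVal, this]
  · simp [move, letterVal, evst_push β h]

lemma evst_dst (g : Dih k) : evst k (dst hk g) = g := by
  obtain ⟨w, rfl⟩ := (gradedGen_artinGen _).gen g
  induction w with
  | nil => rw [evalWord_nil, dst_one]; simp [base, evst, evl]
  | cons s w ih =>
    rw [evalWord_cons]
    erw [dst_letterVal_mul]
    rw [evst_move hk s (valid_dst hk _), ih]

/-- The graded generating family of a dihedral Artin group. -/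
lemma dgg (k : ℕ) : GradedGen (dgen k) := gradedGen_artinGen _

lemma wlen_eq_len (g : Dih k) : wlen (dgen k) g = (dst hk g).len k := by
  apply le_antisymm
  · induction h : (dst hk g).len k using Nat.strong_induction_on generalizing g with
    | _ n ih =>
      by_cases hb : dst hk g = base
      · have : g = 1 := by rw [← evst_dst hk g, hb, ← dst_one hk, evst_dst]
        rw [this, wlen_one]
        omega
      · obtain ⟨s, hs⟩ := exists_len_move_lt hk (valid_dst hk g) hb
        rw [← dst_letterVal_mul] at hs
        have h1 := ih _ (h ▸ hs) _ rfl
        have h2 := wlen_letter_mul (dgg k) s g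
        omega
  · obtain ⟨w, hw, hl⟩ := exists_geodesic (dgg k) g
    rw [← hl, ← hw]
    clear hw hl
    induction w with
    | nil => simp [evalWord_nil, dst_one, len_base]
    | cons s w ih =>
      rw [evalWord_cons, dst_letterVal_mul, List.length_cons]
      obtain ⟨β, b⟩ := s
      have h3 := valid_dst hk (evalWord (dgen k) w)
      cases b
      · have h4 := len_pull hk β h3
        simp only [move, Bool.false_eq_true, if_false]
        split_ifs at h4 <;> omega
      · have h4 := len_push hk β h3
        simp only [move, if_true]
        split_ifs at h4 <;> omega

lemma desc_pos_iff (g : Dih k) (β : Bool) :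
    Desc (dgen k) g (β, true) ↔ 0 < (dst hk g).vec ((dst hk g).posInv k β) := by
  have h1 : (letterVal (dgen k) (β, true))⁻¹ = letterVal (dgen k) (β, false) := by
    simp [letterVal]
  rw [Desc, h1, wlen_eq_len hk, wlen_eq_len hk, dst_letterVal_mul]
  have := len_pull hk β (valid_dst hk g)
  simp only [move, Bool.false_eq_true, if_false]
  split_ifs at this <;> omega

lemma desc_neg_iff (g : Dih k) (β : Bool) :
    Desc (dgen k) g (β, false) ↔ (dst hk g).vec ((dst hk g).pos β) < 0 := by
  have h1 : (letterVal (dgen k) (β, false))⁻¹ = letterVal (dgen k) (β, true) := by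
    simp [letterVal]
  rw [Desc, h1, wlen_eq_len hk, wlen_eq_len hk, dst_letterVal_mul]
  have := len_push hk β (valid_dst hk g)
  simp only [move, if_true]
  split_ifs at this <;> omega

end Action

end ThreeFreeArtin

namespace ThreeFreeArtin

namespace DState

variable {k : ℕ}

lemma vec_antitone (x : DState) {i j : ℕ} (h : i ≤ j) : x.vec j ≤ x.vec i := by
  have : x.l.countP (j < ·) ≤ x.l.countP (i < ·) := by
    apply List.countP_mono_left
    simp
    omega
  simp only [vec]
  omega

/-- An invariant of normal forms reached by a positive power of the letter `β`. -/
def InvPos (k P N : ℕ) (β : Bool) (x : DState) : Prop :=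
  (∀ j, P ≤ j → j < k - N → x.vec j = 0) ∧ ∀ i ∈ x.l.head?, x.f = β ∧ i ≤ P

/-- An invariant of normal forms reached by a negative power of the letter `β`. -/
def InvNeg (k P N : ℕ) (β : Bool) (x : DState) : Prop :=
  (∀ j, P ≤ j → j < k - N → x.vec j = 0) ∧ ∀ i ∈ x.l.head?, x.f = !β ∧ k - N ≤ i

lemma InvPos.push {P N : ℕ} {γ : Bool} {x : DState} (hk : 2 ≤ k) (hx : x.Valid k)
    (hP : P + 1 < k)
    (h : InvPos k P N (!γ) x ∨ InvNeg k P N (!γ) x ∨ InvPos k (P + 1) N γ x) :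
    InvPos k (P + 1) N γ (x.push k γ) := by
  have hv := fun j (hj : j < k) => vec_push hk γ hx hj
  have h0 : ∀ j, P + 1 ≤ j → j < k - N → x.vec j = 0 := by
    intro j h1 h2
    rcases h with h | h | h
    · exact h.1 j (by omega) h2
    · exact h.1 j (by omega) h2
    · exact h.1 j h1 h2
  have h1 : x.pos γ ≤ P ∧ ∀ i ∈ (x.push k γ).l.head?, (x.push k γ).f = γ ∧ i ≤ P + 1 := by
    obtain ⟨κ, f, l⟩ := x
    cases l with
    | nil => simp [DState.push, pos]
    | cons i t =>
      by_cases hf : f = γ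
      · simp [DState.push, pos, hf]
      · have hi : i ≤ P := by
          rcases h with h | h | h
          · exact (h.2 i (by simp)).2
          · exact absurd (by simpa using (h.2 i (by simp)).1) hf
          · exact absurd (h.2 i (by simp)).1 hf
        have hi' : i + 1 ≠ k := by omega
        simp [DState.push, pos, hf, hi, hi']
  refine ⟨fun j h2 h3 => ?_, h1.2⟩
  rw [hv j (by omega), h0 j h2 h3, if_neg (by omega)]
  rfl

lemma InvNeg.pull {P N : ℕ} {γ : Bool} {x : DState} (hk : 2 ≤ k) (hx : x.Valid k)
    (hN : N + 1 < k)
    (h : InvPos k P N (!γ) x ∨ InvNeg k P N (!γ) x ∨ InvNeg k P (N + 1) γ x) :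
    InvNeg k P (N + 1) γ (x.pull k γ) := by
  have hv := fun j (hj : j < k) => vec_pull hk γ hx hj
  have h0 : ∀ j, P ≤ j → j < k - (N + 1) → x.vec j = 0 := by
    intro j h1 h2
    rcases h with h | h | h
    · exact h.1 j h1 (by omega)
    · exact h.1 j h1 (by omega)
    · exact h.1 j h1 h2
  have h1 : k - (N + 1) ≤ x.posInv k γ ∧
      ∀ i ∈ (x.pull k γ).l.head?, (x.pull k γ).f = !γ ∧ k - (N + 1) ≤ i := by
    obtain ⟨κ, f, l⟩ := x
    cases l with
    | nil => simp [DState.pull, posInv]; omega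
    | cons i t =>
      by_cases hf : f = γ
      · have hi : k - N ≤ i := by
          rcases h with h | h | h
          · exact absurd (hf.symm.trans (h.2 i (by simp)).1) (by cases γ <;> simp)
          · exact (h.2 i (by simp)).2
          · exact absurd (hf.symm.trans (h.2 i (by simp)).1) (by cases γ <;> simp)
        have hi' : i ≠ 1 := by omega
        simp [DState.pull, posInv, hf, hi']
        omega
      · have hf' : f = !γ := by revert hf; cases f <;> cases γ <;> simp
        simp [DState.pull, posInv, hf']
        omega
  refine ⟨fun j h2 h3 => ?_, h1.2⟩
  rw [hv j (by omega), h0 j h2 h3, if_neg (by omega)]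
  rfl

/-- The relation between the normal forms of `g` and of the product of `g` with a positive
generator. -/
def RightStep (k : ℕ) (x x' : DState) : Prop :=
  ∃ (h r r' : List ℕ) (e : ℤ), x.l = h ++ r ∧ x'.l = h ++ r' ∧ x'.κ = x.κ + e ∧
    ((r = [] ∧ r' = [1] ∧ e = 0 ∧ (h ≠ [] → x'.f = x.f)) ∨
      (∃ j, j + 1 < k ∧ r = [j] ∧ r' = [j + 1] ∧ e = 0 ∧ x'.f = x.f) ∨
      (r = [k - 1] ∧ r' = [] ∧ e = 1 ∧ x'.f = canon x.f h))

lemma RightStep.vec_le {x x' : DState} (h : RightStep k x x') {j : ℕ} (_hj : j < k) :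
    x.vec j ≤ x'.vec j := by
  obtain ⟨a, r, r', e, h1, h2, h3, h4⟩ := h
  simp only [vec, h1, h2, h3, List.countP_append]
  rcases h4 with ⟨rfl, rfl, rfl, -⟩ | ⟨i, hi, rfl, rfl, rfl, -⟩ | ⟨rfl, rfl, rfl, -⟩
  · simp
    omega
  · simp only [List.countP_cons, List.countP_nil, decide_eq_true_eq]
    split_ifs <;> omega
  · simp only [List.countP_cons, List.countP_nil, decide_eq_true_eq]
    split_ifs <;> omega

lemma RightStep.head {x x' : DState} (h : RightStep k x x') {i i' : ℕ} {t : List ℕ}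
    (hl : x.l = i :: i' :: t) : ∃ t', x'.l = i :: t' ∧ x'.f = x.f := by
  obtain ⟨a, r, r', e, h1, h2, h3, h4⟩ := h
  rw [hl] at h1
  cases a with
  | nil => rcases h4 with ⟨rfl, rfl, rfl, -⟩ | ⟨i, hi, rfl, rfl, rfl, -⟩ | ⟨rfl, rfl, rfl, -⟩ <;>
      simp at h1
  | cons j a =>
    simp only [List.cons_append, List.cons.injEq] at h1 h2
    refine ⟨a ++ r', by rw [h2, h1.1], ?_⟩
    rcases h4 with ⟨-, -, -, h⟩ | ⟨i, -, -, -, -, h⟩ | ⟨-, -, -, h⟩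
    · exact h (by simp)
    · exact h
    · exact h

lemma RightStep.push (hk : 2 ≤ k) {x x' : DState} (γ : Bool)
    (h : RightStep k x x') : RightStep k (x.push k γ) (x'.push k γ) := by
  obtain ⟨a, r, r', e, h1, h2, h3, h4⟩ := h
  obtain ⟨κ, f, l⟩ := x
  obtain ⟨κ', f', l'⟩ := x'
  simp only at h1 h2 h3 h4
  subst h1 h2 h3
  cases a with
  | nil =>
    rcases h4 with ⟨rfl, rfl, rfl, -⟩ | ⟨i, hi, rfl, rfl, rfl, rfl⟩ | ⟨rfl, rfl, rfl, rfl⟩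
    · by_cases hf : f' = γ
      · exact ⟨[1], [], [1], 0, by simp [DState.push], by simp [DState.push, hf],
          by simp [DState.push, hf], Or.inl (by simp [DState.push, hf])⟩
      · by_cases h2 : k = 2
        · subst h2
          exact ⟨[], [1], [], 1, by simp [DState.push], by simp [DState.push, hf],
            by simp [DState.push, hf], Or.inr (Or.inr (by simp [DState.push, hf, canon]))⟩
        · have h3 : 1 + 1 ≠ k := by omega
          exact ⟨[], [1], [2], 0, by simp [DState.push], by simp [DState.push, hf, h3],
            by simp [DState.push, hf, h3],
            Or.inr (Or.inl ⟨1, by omega, by simp [DState.push, hf, h3]⟩)⟩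
    · by_cases hf : f' = γ
      · exact ⟨[1], [i], [i + 1], 0, by simp [DState.push, hf], by simp [DState.push, hf],
          by simp [DState.push, hf], Or.inr (Or.inl ⟨i, hi, by simp [DState.push, hf]⟩)⟩
      · have h3 : i + 1 ≠ k := by omega
        by_cases h2 : i + 1 + 1 = k
        · have h4 : i + 1 = k - 1 := by omega
          exact ⟨[], [k - 1], [], 1, by simp [DState.push, hf, h3]; omega,
            by simp [DState.push, hf, h2],
            by simp [DState.push, hf, h2, h3],
            Or.inr (Or.inr (by simp [DState.push, hf, h2, canon]))⟩
        · exact ⟨[], [i + 1], [i + 1 + 1], 0, by simp [DState.push, hf, h3],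
            by simp [DState.push, hf, h2],
            by simp [DState.push, hf, h2, h3],
            Or.inr (Or.inl ⟨i + 1, by omega, by simp [DState.push, hf, h2, h3]⟩)⟩
    · have h3 : k - 1 + 1 = k := by omega
      by_cases hf : f = γ
      · exact ⟨[1], [k - 1], [], 1, by simp [DState.push, hf], by simp [DState.push],
          by simp [DState.push, hf], Or.inr (Or.inr (by simp [DState.push, hf, canon]))⟩
      · exact ⟨[], [], [1], 0, by simp [DState.push, hf, h3], by simp [DState.push],
          by simp [DState.push, hf, h3], Or.inl (by simp)⟩
  | cons i a =>
    have hf' : f' = f := by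
      rcases h4 with ⟨-, -, -, h⟩ | ⟨i, -, -, -, -, h⟩ | ⟨-, -, -, h⟩
      · exact h (by simp)
      · exact h
      · exact h
    subst hf'
    by_cases hf : f' = γ
    · refine ⟨1 :: i :: a, r, r', e, by simp [DState.push, hf], by simp [DState.push, hf],
        by simp [DState.push, hf], ?_⟩
      simpa [DState.push, hf, canon] using h4
    · by_cases h2 : i + 1 = k
      · refine ⟨a, r, r', e, by simp [DState.push, hf, h2], by simp [DState.push, hf, h2],
          by simp [DState.push, hf, h2]; ring, ?_⟩
        rcases h4 with ⟨rfl, rfl, rfl, -⟩ | ⟨i, hi, rfl, rfl, rfl, -⟩ | ⟨rfl, rfl, rfl, -⟩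
        · left
          cases a <;> simp [DState.push, hf, h2, canon]
        · right; left
          refine ⟨i, hi, ?_⟩
          cases a <;> simp [DState.push, hf, h2, canon]
        · right; right
          cases a <;> simp [DState.push, hf, h2, canon]
      · refine ⟨(i + 1) :: a, r, r', e, by simp [DState.push, hf, h2],
          by simp [DState.push, hf, h2], by simp [DState.push, hf, h2], ?_⟩
        simpa [DState.push, hf, h2, canon] using h4

lemma RightStep.pull (hk : 2 ≤ k) {x x' : DState} (γ : Bool) (hx : x.Valid k)
    (h : RightStep k x x') : RightStep k (x.pull k γ) (x'.pull k γ) := by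
  obtain ⟨a, r, r', e, h1, h2, h3, h4⟩ := h
  obtain ⟨κ, f, l⟩ := x
  obtain ⟨κ', f', l'⟩ := x'
  simp only at h1 h2 h3 h4
  subst h1 h2 h3
  have hx1 := hx.1
  simp only at hx1
  have e1 : ∀ {b : Bool}, b ≠ γ → b = !γ := by
    intro b
    cases b <;> cases γ <;> simp
  cases a with
  | nil =>
    rcases h4 with ⟨rfl, rfl, rfl, -⟩ | ⟨i, hi, rfl, rfl, rfl, rfl⟩ | ⟨rfl, rfl, rfl, rfl⟩
    · by_cases hf : f' = γ
      · exact ⟨[], [k - 1], [], 1, by simp [DState.pull], by simp [DState.pull, hf],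
          by simp [DState.pull, hf], Or.inr (Or.inr (by simp [DState.pull, hf, canon]))⟩
      · exact ⟨[k - 1], [], [1], 0, by simp [DState.pull], by simp [DState.pull, hf],
          by simp [DState.pull, hf], Or.inl (by simp [DState.pull, e1 hf])⟩
    · have hi0 := (hx1 i (by simp)).1
      by_cases hf : f' = γ
      · by_cases h2 : i = 1
        · subst h2
          exact ⟨[], [], [1], 0, by simp [DState.pull, hf], by simp [DState.pull, hf],
            by simp [DState.pull, hf], Or.inl (by simp)⟩
        · have h3 : i ≠ 0 := by omega
          exact ⟨[], [i - 1], [i - 1 + 1], 0, by simp [DState.pull, hf, h2],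
            by simp [DState.pull, hf, h3]; omega, by simp [DState.pull, hf, h2, h3],
            Or.inr (Or.inl ⟨i - 1, by omega, by simp [DState.pull, hf, h2, h3]⟩)⟩
      · exact ⟨[k - 1], [i], [i + 1], 0, by simp [DState.pull, hf], by simp [DState.pull, hf],
          by simp [DState.pull, hf], Or.inr (Or.inl ⟨i, hi, by simp [DState.pull, hf]⟩)⟩
    · by_cases hf : f = γ
      · by_cases h2 : k = 2
        · subst h2
          exact ⟨[], [], [1], 0, by simp [DState.pull, hf], by simp [DState.pull],
            by simp [DState.pull, hf], Or.inl (by simp)⟩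
        · have h3 : ¬ k - 1 = 1 := by omega
          have h4 : k - 1 - 1 + 1 = k - 1 := by omega
          exact ⟨[], [k - 1 - 1], [k - 1 - 1 + 1], 0, by simp [DState.pull, hf, h3],
            by simp [DState.pull, h4], by simp [DState.pull, hf, h3],
            Or.inr (Or.inl ⟨k - 1 - 1, by omega, by simp [DState.pull, hf, h3]⟩)⟩
      · exact ⟨[k - 1], [k - 1], [], 1, by simp [DState.pull, hf], by simp [DState.pull],
          by simp [DState.pull, hf], Or.inr (Or.inr (by simp [DState.pull, canon, e1 hf]))⟩
  | cons i a =>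
    have hf' : f' = f := by
      rcases h4 with ⟨-, -, -, h⟩ | ⟨i, -, -, -, -, h⟩ | ⟨-, -, -, h⟩
      · exact h (by simp)
      · exact h
      · exact h
    subst hf'
    by_cases hf : f' = γ
    · by_cases h2 : i = 1
      · refine ⟨a, r, r', e, by simp [DState.pull, hf, h2], by simp [DState.pull, hf, h2],
          by simp [DState.pull, hf, h2], ?_⟩
        rcases h4 with ⟨rfl, rfl, rfl, -⟩ | ⟨i, hi, rfl, rfl, rfl, -⟩ | ⟨rfl, rfl, rfl, -⟩
        · left
          cases a <;> simp [DState.pull, hf, h2, canon]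
        · right; left
          refine ⟨i, hi, ?_⟩
          cases a <;> simp [DState.pull, hf, h2, canon]
        · right; right
          cases a <;> simp [DState.pull, hf, h2, canon]
      · refine ⟨(i - 1) :: a, r, r', e, by simp [DState.pull, hf, h2],
          by simp [DState.pull, hf, h2], by simp [DState.pull, hf, h2], ?_⟩
        simpa [DState.pull, hf, h2, canon] using h4
    · refine ⟨(k - 1) :: i :: a, r, r', e, by simp [DState.pull, hf], by simp [DState.pull, hf],
        by simp [DState.pull, hf]; ring, ?_⟩
      simpa [DState.pull, hf, canon] using h4

end DState

end ThreeFreeArtin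

namespace ThreeFreeArtin

open DState

section Dihedral

variable {k : ℕ} (hk : 2 ≤ k)
include hk

lemma dih_not_desc_both (g : Dih k) (s : Bool × Bool) (h : Desc (dgen k) g s) :
    ¬ Desc (dgen k) g (letterInv s) := by
  have key : ∀ β, Desc (dgen k) g (β, true) → Desc (dgen k) g (β, false) → False := by
    intro β h1 h2
    rw [desc_pos_iff hk] at h1
    rw [desc_neg_iff hk] at h2
    have hv := valid_dst hk g
    generalize dst hk g = x at *
    have hm := fun i j => x.vec_antitone (i := i) (j := j)
    obtain ⟨κ, f, l⟩ := x
    cases l with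
    | nil => simp [posInv, pos, vec] at h1 h2; omega
    | cons i t =>
      have hi := hv.1 i (by simp)
      by_cases hf : f = β
      · simp only [posInv, pos, hf, if_true] at h1 h2
        have := hm 0 (i - 1) (by omega)
        simp only [hf] at this
        omega
      · simp only [posInv, pos, hf, if_false] at h1 h2
        have := hm i (k - 1) (by omega)
        omega
  obtain ⟨β, b⟩ := s
  intro h'
  cases b
  · exact key β h' h
  · exact key β h h'

lemma dih_crit {g : Dih k} {b b' : Bool} (h1 : Desc (dgen k) g (true, b))
    (h2 : Desc (dgen k) g (false, b')) {j : ℕ} (hj : j < k) : (dst hk g).vec j ≠ 0 := by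
  have d1 := fun β => desc_pos_iff hk g β
  have d2 := fun β => desc_neg_iff hk g β
  have h3 : ∀ β, 0 < (dst hk g).vec ((dst hk g).posInv k β) ∨
      (dst hk g).vec ((dst hk g).pos β) < 0 := by
    intro β
    rw [← d1, ← d2]
    cases β
    · cases b' <;> tauto
    · cases b <;> tauto
  clear d1 d2 h1 h2
  have hv := valid_dst hk g
  generalize dst hk g = x at *
  have hm := fun i j => x.vec_antitone (i := i) (j := j)
  obtain ⟨κ, f, l⟩ := x
  cases l with
  | nil =>
    have := h3 true
    simp [posInv, pos, vec] at this ⊢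
    omega
  | cons i t =>
    have hi := hv.1 i (by simp)
    have h4 := h3 f
    have h5 := h3 !f
    simp only [posInv, pos, if_true] at h4 h5
    rw [if_neg (by simp), if_neg (by simp)] at h5
    have a1 := hm j (k - 1) (by omega)
    have a2 := hm 0 j (by omega)
    rcases lt_or_ge j i with h6 | h6
    · have a3 := hm j (i - 1) (by omega)
      omega
    · have a3 := hm i j (by omega)
      omega

lemma dst_gen_mul (β : Bool) (g : Dih k) : dst hk (dgen k β * g) = (dst hk g).push k β :=
  dst_letterVal_mul hk (β, true) g

lemma dst_gen_inv_mul (β : Bool) (g : Dih k) :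
    dst hk ((dgen k β)⁻¹ * g) = (dst hk g).pull k β :=
  dst_letterVal_mul hk (β, false) g

lemma dst_zpow_mul {P N : ℕ} (hPN : P + N + 1 < k) {γ : Bool} {g : Dih k}
    (h : InvPos k P N (!γ) (dst hk g) ∨ InvNeg k P N (!γ) (dst hk g)) {q : ℤ} (hq : q ≠ 0) :
    (0 < q ∧ InvPos k (P + 1) N γ (dst hk (dgen k γ ^ q * g))) ∨
      (q < 0 ∧ InvNeg k P (N + 1) γ (dst hk (dgen k γ ^ q * g))) := by
  obtain ⟨n, rfl | rfl⟩ := q.eq_nat_or_neg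
  · left
    obtain ⟨n, rfl⟩ : ∃ j, n = j + 1 := ⟨n - 1, by omega⟩
    refine ⟨by omega, ?_⟩
    clear hq
    induction n with
    | zero =>
      simp only [zero_add, Nat.cast_one, zpow_one]
      rw [dst_gen_mul hk]
      exact InvPos.push hk (valid_dst hk g) (by omega) (by tauto)
    | succ n ih =>
      have : dgen k γ ^ ((n + 1 + 1 : ℕ) : ℤ) * g = dgen k γ * (dgen k γ ^ ((n + 1 : ℕ) : ℤ) * g) := by
        rw [← mul_assoc, zpow_natCast, zpow_natCast, ← pow_succ']
      rw [this, dst_gen_mul hk]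
      exact InvPos.push hk (valid_dst hk _) (by omega) (Or.inr (Or.inr ih))
  · right
    obtain ⟨n, rfl⟩ : ∃ j, n = j + 1 := ⟨n - 1, by omega⟩
    refine ⟨by omega, ?_⟩
    clear hq
    induction n with
    | zero =>
      simp only [zero_add, Nat.cast_one, zpow_neg, zpow_one]
      rw [dst_gen_inv_mul hk]
      exact InvNeg.pull hk (valid_dst hk g) (by omega) (by tauto)
    | succ n ih =>
      have : dgen k γ ^ (-(n + 1 + 1 : ℕ) : ℤ) * g =
          (dgen k γ)⁻¹ * (dgen k γ ^ (-(n + 1 : ℕ) : ℤ) * g) := by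
        rw [← mul_assoc, zpow_neg, zpow_neg, zpow_natCast, zpow_natCast, ← mul_inv_rev, ← pow_succ]
      rw [this, dst_gen_inv_mul hk]
      exact InvNeg.pull hk (valid_dst hk _) (by omega) (Or.inr (Or.inr ih))

lemma invPos_one (γ : Bool) : InvPos k 0 0 γ (dst hk 1) := by
  rw [dst_one]
  simp [InvPos, base, vec]

lemma dih_zpow_not_desc (β : Bool) (p : ℤ) (b : Bool) :
    ¬ Desc (dgen k) (dgen k β ^ p) (!β, b) := by
  by_cases hp : p = 0
  · subst hp
    rw [zpow_zero, Desc, wlen_one]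
    omega
  have h := dst_zpow_mul hk (by omega) (Or.inl (invPos_one hk (!β))) hp
  rw [mul_one] at h
  have h2 : (dst hk (dgen k β ^ p)).vec ((dst hk (dgen k β ^ p)).posInv k !β) = 0 ∧
      (dst hk (dgen k β ^ p)).vec ((dst hk (dgen k β ^ p)).pos !β) = 0 := by
    have hv := valid_dst hk (dgen k β ^ p)
    generalize dst hk (dgen k β ^ p) = x at *
    obtain ⟨κ, f, l⟩ := x
    rcases h with ⟨-, h1, h2⟩ | ⟨-, h1, h2⟩
    · cases l with
      | nil =>
        have := h1 1 (by omega) (by omega)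
        simpa [vec] using this
      | cons i t =>
        have hi := hv.1 i (by simp)
        obtain ⟨h3, h4⟩ := h2 i (by simp)
        simp only at h3
        subst h3
        simp only [posInv, pos]
        rw [if_neg (by simp), if_neg (by simp)]
        exact ⟨h1 _ (by omega) (by omega), h1 _ (by omega) (by omega)⟩
    · cases l with
      | nil =>
        have := h1 0 (by omega) (by omega)
        simpa [vec] using this
      | cons i t =>
        have hi := hv.1 i (by simp)
        obtain ⟨h3, h4⟩ := h2 i (by simp)
        simp only at h3
        subst h3
        simp only [posInv, pos, if_true]
        exact ⟨h1 _ (by omega) (by omega), h1 _ (by omega) (by omega)⟩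
  cases b
  · rw [desc_neg_iff hk]; omega
  · rw [desc_pos_iff hk]; omega

lemma dih_three_syllables (hk4 : 4 ≤ k) (β : Bool) (p q r : ℤ) (b b' : Bool)
    (h1 : Desc (dgen k) (dgen k β ^ p * dgen k (!β) ^ q * dgen k β ^ r) (true, b)) :
    ¬ Desc (dgen k) (dgen k β ^ p * dgen k (!β) ^ q * dgen k β ^ r) (false, b') := by
  intro h2
  by_cases hq : q = 0
  · subst hq
    rw [zpow_zero, mul_one, ← zpow_add] at h1 h2
    cases β
    · exact dih_zpow_not_desc hk _ _ _ h1
    · exact dih_zpow_not_desc hk _ _ _ h2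
  have e1 : ∃ P N, P + N ≤ 1 ∧ (InvPos k P N β (dst hk (dgen k β ^ r)) ∨
      InvNeg k P N β (dst hk (dgen k β ^ r))) := by
    by_cases hr : r = 0
    · subst hr
      rw [zpow_zero]
      exact ⟨0, 0, by omega, Or.inl (invPos_one hk β)⟩
    · have h := dst_zpow_mul hk (by omega) (Or.inl (invPos_one hk (!β))) hr
      rw [mul_one] at h
      rcases h with h | h
      · exact ⟨_, _, by omega, Or.inl h.2⟩
      · exact ⟨_, _, by omega, Or.inr h.2⟩
  have e2 : ∃ P N, P + N ≤ 2 ∧ (InvPos k P N (!β) (dst hk (dgen k (!β) ^ q * dgen k β ^ r)) ∨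
      InvNeg k P N (!β) (dst hk (dgen k (!β) ^ q * dgen k β ^ r))) := by
    obtain ⟨P, N, h3, h4⟩ := e1
    have := dst_zpow_mul hk (P := P) (N := N) (γ := !β) (by omega)
      (by rw [Bool.not_not]; exact h4) hq
    rcases this with h | h
    · exact ⟨_, _, by omega, Or.inl h.2⟩
    · exact ⟨_, _, by omega, Or.inr h.2⟩
  rw [mul_assoc] at h1 h2
  have e3 : ∃ j < k, (dst hk (dgen k β ^ p * (dgen k (!β) ^ q * dgen k β ^ r))).vec j = 0 := by
    obtain ⟨P, N, h3, h4⟩ := e2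
    by_cases hp : p = 0
    · subst hp
      rw [zpow_zero, one_mul]
      refine ⟨P, by omega, ?_⟩
      rcases h4 with h | h <;> exact h.1 P le_rfl (by omega)
    · rcases dst_zpow_mul hk (by omega) h4 hp with h | h
      · exact ⟨P + 1, by omega, h.2.1 _ le_rfl (by omega)⟩
      · exact ⟨P, by omega, h.2.1 _ le_rfl (by omega)⟩
  obtain ⟨j, hj, h3⟩ := e3
  exact dih_crit hk h1 h2 hj h3

lemma dst_mul_gen (g : Dih k) (b : Bool) : RightStep k (dst hk g) (dst hk (g * dgen k b)) := by
  obtain ⟨w, rfl⟩ := (dgg k).gen g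
  induction w with
  | nil =>
    rw [evalWord_nil, one_mul, dst_one, ← mul_one (dgen k b), dst_gen_mul, dst_one]
    exact ⟨[], [], [1], 0, by simp [base], by simp [base, push], by simp [base, push],
      Or.inl (by simp)⟩
  | cons s w ih =>
    rw [evalWord_cons, mul_assoc, dst_letterVal_mul, dst_letterVal_mul]
    obtain ⟨β, b⟩ := s
    cases b
    · exact ih.pull hk β (valid_dst hk _)
    · exact ih.push hk β

/-- The dihedral case of the two-sided extension property, for positive letters. -/
lemma dih_extend_pos (g : Dih k) (a b : Bool)
    (h1 : wlen (dgen k) (dgen k a * g) = wlen (dgen k) g + 1)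
    (h2 : wlen (dgen k) (g * dgen k b) = wlen (dgen k) g + 1) :
    wlen (dgen k) (dgen k a * g * dgen k b) = wlen (dgen k) g + 2 := by
  by_contra hne
  have hD := dgg k
  have h3 : wlen (dgen k) (dgen k a * g * dgen k b) = wlen (dgen k) g := by
    have := wlen_mul_letter hD (b, true) (dgen k a * g)
    simp only [letterVal, if_true] at this
    omega
  set h := dgen k a * g * dgen k b with hh
  have hda : ¬ Desc (dgen k) h (a, true) := by
    rw [not_desc_iff hD]
    have : (letterVal (dgen k) (a, true))⁻¹ * h = g * dgen k b := by
      simp [letterVal, hh, mul_assoc]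
    rw [this, h2, h3]
  have hka : Desc (dgen k) (dgen k a * g) (a, true) := by
    rw [desc_iff hD, h1]
    simp [letterVal]
  have h_one : h ≠ 1 := by
    intro h4
    obtain ⟨σ, hσ, hσ2, -⟩ := exists_degree hD
    have h5 : g = 1 := by
      rw [← wlen_eq_zero hD, ← h3, h4, wlen_one]
    have h6 := congrArg σ h4
    rw [hh, h5, mul_one, map_mul, hσ, hσ, map_one σ, ← ofAdd_add] at h6
    have := congrArg Multiplicative.toAdd h6
    simp at this
  obtain ⟨t, ht⟩ := exists_desc hD h_one
  have htk : Desc (dgen k) (dgen k a * g) t := by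
    rw [Desc]
    have h4 := wlen_mul_letter hD (b, true) ((letterVal (dgen k) t)⁻¹ * (dgen k a * g))
    rw [desc_iff hD] at ht
    have h5 : (letterVal (dgen k) t)⁻¹ * (dgen k a * g) * letterVal (dgen k) (b, true) =
      (letterVal (dgen k) t)⁻¹ * h := by
      simp [letterVal, hh, mul_assoc]
    rw [h5] at h4
    omega
  have ht1 : t.1 = !a := by
    by_contra hcon
    have : t.1 = (a, true).1 := by
      revert hcon; cases t.1 <;> cases a <;> simp
    rcases eq_or_eq_letterInv this with rfl | rfl
    · exact hda ht
    · exact dih_not_desc_both hk _ _ hka htk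
  have hcrit : ∀ j < k, (dst hk (dgen k a * g)).vec j ≠ 0 := by
    intro j hj
    obtain ⟨t1, t2⟩ := t
    simp only at ht1
    subst ht1
    cases a
    · exact dih_crit hk htk hka hj
    · exact dih_crit hk hka htk hj
  have hstep := dst_mul_gen hk (dgen k a * g) b
  rw [← hh] at hstep
  have hlen : (dst hk (dgen k a * g)).len k = (dst hk h).len k + 1 := by
    rw [← wlen_eq_len, ← wlen_eq_len, h3, h1]
  rw [desc_pos_iff hk] at hda hka
  have hv := valid_dst hk (dgen k a * g)
  generalize dst hk (dgen k a * g) = x at *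
  generalize dst hk h = y at *
  rcases lt_or_gt_of_ne (hcrit (k - 1) (by omega)) with h4 | h4
  · have hm := fun i j => x.vec_antitone (i := i) (j := j)
    obtain ⟨κ, f, l⟩ := x
    match l with
    | [] => simp [posInv, vec] at hka h4; omega
    | i :: t =>
      have hi := hv.1 i (by simp)
      simp only [posInv] at hka
      split_ifs at hka with hf
      · match t with
        | [] =>
          simp only [vec, List.countP_cons, List.countP_nil, decide_eq_true_eq] at hka h4
          split_ifs at hka h4 <;> omega
        | i' :: t =>
          obtain ⟨t', h5, h6⟩ := hstep.head rfl
          apply hda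
          have h7 := hstep.vec_le (j := i - 1) (by omega)
          obtain ⟨κ', f', l'⟩ := y
          simp only at h5 h6
          subst h5 h6
          simp only [posInv, hf, if_true]
          simp only [hf] at h7 hka
          omega
      · omega
  · have h5 : x.len k ≤ y.len k := by
      unfold len
      refine Finset.sum_le_sum fun j hj => ?_
      rw [Finset.mem_range] at hj
      have h6 := hstep.vec_le hj
      have h7 := x.vec_antitone (i := j) (j := k - 1) (by omega)
      omega
    omega

/-- The dihedral case of the two-sided extension property. -/
lemma dih_extend (g : Dih k) (a b ε : Bool)
    (h1 : wlen (dgen k) (letterVal (dgen k) (a, ε) * g) = wlen (dgen k) g + 1)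
    (h2 : wlen (dgen k) (g * letterVal (dgen k) (b, ε)) = wlen (dgen k) g + 1) :
    wlen (dgen k) (letterVal (dgen k) (a, ε) * g * letterVal (dgen k) (b, ε)) =
      wlen (dgen k) g + 2 := by
  cases ε
  · have hD := dgg k
    simp only [letterVal, Bool.false_eq_true, if_false] at h1 h2 ⊢
    have h3 := dih_extend_pos hk g⁻¹ b a
    rw [← wlen_inv hD (_ * _), ← wlen_inv hD (_ * _), wlen_inv hD g,
      ← wlen_inv hD (_ * _ * _)] at h3
    simp only [mul_inv_rev, inv_inv] at h3
    rw [mul_assoc]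
    exact h3 h2 h1
  · exact dih_extend_pos hk g a b h1 h2

end Dihedral

section Commuting

lemma dih_two_comm (s t : Bool × Bool) : letterVal (dgen 2) s * letterVal (dgen 2) t =
    letterVal (dgen 2) t * letterVal (dgen 2) s := by
  have h : ∀ x y, Commute (dgen 2 x) (dgen 2 y) := by
    have h0 : Commute (dgen 2 true) (dgen 2 false) := by
      have := altMul_artinGen (m := fun _ _ : Bool => ((2 : ℕ) : ℕ∞)) (x := true) (y := false)
        (by simp) rfl
      simp only [altMul, mul_one] at this
      exact this
    intro x y
    cases x <;> cases y
    exacts [Commute.refl _, h0.symm, h0, Commute.refl _]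
  obtain ⟨x, b⟩ := s
  obtain ⟨y, c⟩ := t
  have := h x y
  cases b <;> cases c <;> simp only [letterVal, if_true, Bool.false_eq_true, if_false]
  exacts [this.inv_inv.eq, this.inv_left.eq, this.inv_right.eq, this.eq]

/-- The exponent sum of a generator in a dihedral Artin group with commuting generators. -/
noncomputable def dihTwoExp (β : Bool) : Dih 2 →* Multiplicative ℤ :=
  artinLift (fun b => if b = β then Multiplicative.ofAdd 1 else 1) (fun x y _ n hn => by
    obtain rfl : 2 = n := by exact_mod_cast hn
    simp [altMul, mul_comm])

lemma dihTwoExp_letterVal (β : Bool) (s : Bool × Bool) :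
    (dihTwoExp β (letterVal (dgen 2) s)).toAdd =
      if s.1 = β then (if s.2 then 1 else -1) else 0 := by
  have h : ∀ b, dihTwoExp β (dgen 2 b) = if b = β then Multiplicative.ofAdd 1 else 1 :=
    fun b => artinLift_gen _ _ b
  rw [map_letterVal]
  obtain ⟨b, c⟩ := s
  by_cases hb : b = β <;> cases c <;> simp [letterVal, h, hb]

lemma dih_two_eq (g : Dih 2) : g = dgen 2 true ^ (dihTwoExp true g).toAdd *
    dgen 2 false ^ (dihTwoExp false g).toAdd := by
  obtain ⟨w, rfl⟩ := (dgg 2).gen g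
  have hc : Commute (dgen 2 true) (dgen 2 false) := dih_two_comm (true, true) (false, true)
  induction w with
  | nil => simp [evalWord_nil]
  | cons s w ih =>
    rw [evalWord_cons, map_mul (dihTwoExp true), map_mul (dihTwoExp false), toAdd_mul, toAdd_mul, dihTwoExp_letterVal,
      dihTwoExp_letterVal, zpow_add, zpow_add]
    conv_lhs => rw [ih]
    generalize (dihTwoExp true (evalWord (dgen 2) w)).toAdd = p
    generalize (dihTwoExp false (evalWord (dgen 2) w)).toAdd = q
    obtain ⟨b, c⟩ := s
    have h1 := (hc.zpow_left p).symm.eq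
    have h2 := (hc.zpow_left p).inv_right.symm.eq
    cases b <;> cases c <;> simp [letterVal, mul_assoc]
    · rw [← mul_assoc, h2, mul_assoc]
    · rw [← mul_assoc, h1, mul_assoc]

lemma wlen_dih_two (g : Dih 2) : wlen (dgen 2) g =
    (dihTwoExp true g).toAdd.natAbs + (dihTwoExp false g).toAdd.natAbs := by
  have hp : ∀ (β : Bool) (p : ℤ), wlen (dgen 2) (dgen 2 β ^ p) ≤ p.natAbs := by
    intro β p
    have hn : ∀ n : ℕ, wlen (dgen 2) (dgen 2 β ^ n) ≤ n := by
      intro n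
      induction n with
      | zero => rw [pow_zero, wlen_one]
      | succ n ih =>
        have h1 := wlen_mul_le (dgg 2) (dgen 2 β ^ n) (dgen 2 β)
        have h2 := wlen_letterVal_le (dgen 2) (β, true)
        simp only [letterVal, if_true] at h2
        rw [pow_succ]
        omega
    obtain ⟨n, rfl | rfl⟩ := p.eq_nat_or_neg
    · simpa using hn n
    · rw [zpow_neg, wlen_inv (dgg 2)]
      simpa using hn n
  apply le_antisymm
  · conv_lhs => rw [dih_two_eq g]
    exact (wlen_mul_le (dgg 2) _ _).trans (add_le_add (hp _ _) (hp _ _))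
  · obtain ⟨w, hw, hl⟩ := exists_geodesic (dgg 2) g
    rw [← hl, ← hw]
    clear hw hl
    induction w with
    | nil => simp [evalWord_nil]
    | cons s w ih =>
      rw [evalWord_cons, map_mul (dihTwoExp true), map_mul (dihTwoExp false), toAdd_mul, toAdd_mul, dihTwoExp_letterVal,
        dihTwoExp_letterVal, List.length_cons]
      obtain ⟨b, c⟩ := s
      cases b <;> cases c <;> simp <;> omega

lemma dih_two_desc {g : Dih 2} {s t : Bool × Bool} (hst : s.1 ≠ t.1)
    (ht : Desc (dgen 2) g t) : Desc (dgen 2) ((letterVal (dgen 2) s)⁻¹ * g) t := by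
  unfold Desc at *
  simp only [wlen_dih_two, map_mul, toAdd_mul, map_inv, toAdd_inv, dihTwoExp_letterVal] at *
  obtain ⟨x, b⟩ := s
  obtain ⟨y, c⟩ := t
  cases x <;> cases y <;> simp_all

end Commuting

section Swap

variable (k : ℕ)

/-- The automorphism of a dihedral Artin group exchanging the generators. -/
noncomputable def dswap : Dih k →* Dih k :=
  artinLift (fun b => dgen k !b) (fun x y hxy n hn =>
    altMul_artinGen (by simpa using hxy) hn)

variable {k}

lemma dswap_letterVal (s : Bool × Bool) :
    dswap k (letterVal (dgen k) s) = letterVal (dgen k) (!s.1, s.2) := by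
  rw [map_letterVal]
  obtain ⟨b, c⟩ := s
  cases c <;> simp [letterVal, dswap]

lemma dswap_dswap (g : Dih k) : dswap k (dswap k g) = g := by
  obtain ⟨w, rfl⟩ := (dgg k).gen g
  induction w with
  | nil => simp [evalWord_nil]
  | cons s w ih => simp [evalWord_cons, ih, dswap_letterVal]

lemma dswap_evalWord (w : Word Bool) : dswap k (evalWord (dgen k) w) =
    evalWord (dgen k) (w.map fun s => (!s.1, s.2)) := by
  induction w with
  | nil => simp [evalWord_nil]
  | cons s w ih => simp [evalWord_cons, ih, dswap_letterVal]

lemma wlen_dswap_le (g : Dih k) : wlen (dgen k) (dswap k g) ≤ wlen (dgen k) g := by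
  obtain ⟨w, hw, hl⟩ := exists_geodesic (dgg k) g
  rw [← hl, ← hw, dswap_evalWord]
  simpa using wlen_evalWord_le (dgen k) (w.map fun s => (!s.1, s.2))

lemma wlen_dswap (g : Dih k) : wlen (dgen k) (dswap k g) = wlen (dgen k) g := by
  refine le_antisymm (wlen_dswap_le g) ?_
  simpa [dswap_dswap] using wlen_dswap_le (dswap k g)

lemma desc_dswap {g : Dih k} {s : Bool × Bool} :
    Desc (dgen k) (dswap k g) (!s.1, s.2) ↔ Desc (dgen k) g s := by
  rw [Desc, Desc, ← dswap_letterVal, ← map_inv, ← map_mul, wlen_dswap, wlen_dswap]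

end Swap

end ThreeFreeArtin

namespace ThreeFreeArtin

variable {X : Type*}

/-- Admissible labellings: symmetric, all labels at least two, no label three. -/
structure Adm (m : X → X → ℕ∞) : Prop where
  symm : ∀ x y, m x y = m y x
  two_le : ∀ x y, x ≠ y → 2 ≤ m x y
  ne_three : ∀ x y, x ≠ y → m x y ≠ 3

/-- An ordered pair of distinct vertices with finite label `k`. -/
structure Pair (m : X → X → ℕ∞) (x y : X) (k : ℕ) : Prop where
  ne : x ≠ y
  lab : m x y = k

/-- The embedding of `Bool` in `X` given by two vertices. -/
def pr (x y : X) (b : Bool) : X := if b then x else y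

/-- The letter over `X` corresponding to a dihedral letter. -/
def lt (x y : X) (s : Bool × Bool) : X × Bool := (pr x y s.1, s.2)

lemma lt_letterInv (x y : X) (s : Bool × Bool) : lt x y (letterInv s) = letterInv (lt x y s) := rfl

lemma lt_swap (x y : X) (s : Bool × Bool) : lt y x (!s.1, s.2) = lt x y s := by
  obtain ⟨b, c⟩ := s
  cases b <;> rfl

variable {m : X → X → ℕ∞}

lemma Pair.symm (A : Adm m) {x y : X} {k : ℕ} (P : Pair m x y k) : Pair m y x k :=
  ⟨P.ne.symm, by rw [A.symm, P.lab]⟩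

lemma Pair.two_le (A : Adm m) {x y : X} {k : ℕ} (P : Pair m x y k) : 2 ≤ k := by
  have := A.two_le x y P.ne
  rw [P.lab] at this
  exact_mod_cast this

lemma Pair.ne_three (A : Adm m) {x y : X} {k : ℕ} (P : Pair m x y k) : k ≠ 3 := by
  have := A.ne_three x y P.ne
  rw [P.lab] at this
  exact_mod_cast this

lemma Pair.eq {x y : X} {k l : ℕ} (P : Pair m x y k) (P' : Pair m x y l) : k = l := by
  have := P.lab.symm.trans P'.lab
  exact_mod_cast this

lemma Pair.lt_inj {x y : X} {k : ℕ} (P : Pair m x y k) {s t : Bool × Bool}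
    (h : lt x y s = lt x y t) : s = t := by
  obtain ⟨b, c⟩ := s
  obtain ⟨b', c'⟩ := t
  have := P.ne
  have := P.ne.symm
  cases b <;> cases b' <;> simp_all [lt, pr]

lemma Pair.lt_fst_ne {x y : X} {k : ℕ} (P : Pair m x y k) {s t : Bool × Bool}
    (h : s.1 ≠ t.1) : (lt x y s).1 ≠ (lt x y t).1 := by
  obtain ⟨b, c⟩ := s
  obtain ⟨b', c'⟩ := t
  have := P.ne
  have := P.ne.symm
  cases b <;> cases b' <;> simp_all [lt, pr]

variable (m) in
/-- The defining relations of the monoid of formal words: geodesic words in a dihedral subgroup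
representing the same element are identified. -/
def qrel (a b : FreeMonoid (X × Bool)) : Prop :=
  ∃ (x y : X) (k : ℕ) (d d' : Word Bool), Pair m x y k ∧ IsGeodesic (dgen k) d ∧
    IsGeodesic (dgen k) d' ∧ evalWord (dgen k) d = evalWord (dgen k) d' ∧
    a = FreeMonoid.ofList (d.map (lt x y)) ∧ b = FreeMonoid.ofList (d'.map (lt x y))

variable (m) in
/-- The monoid of words over the letters modulo dihedral geodesic rewriting. -/
abbrev Q : Type _ := (conGen (qrel m)).Quotient

variable (m) in
/-- The class of a letter. -/
def qof (s : X × Bool) : Q m := ((FreeMonoid.of s : FreeMonoid (X × Bool)) : Q m)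

variable (m) in
/-- The class of a word. -/
def qw (w : Word X) : Q m := ((FreeMonoid.ofList w : FreeMonoid (X × Bool)) : Q m)

lemma qw_nil : qw m [] = 1 := rfl
lemma qw_cons (s : X × Bool) (w : Word X) : qw m (s :: w) = qof m s * qw m w := rfl
lemma qw_append (v w : Word X) : qw m (v ++ w) = qw m v * qw m w := rfl
lemma exists_qw (q : Q m) : ∃ w, q = qw m w := by
  obtain ⟨w, rfl⟩ := Con.mk'_surjective (c := conGen (qrel m)) q
  exact ⟨w.toList, rfl⟩

lemma qw_eq_iff {v w : Word X} : qw m v = qw m w ↔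
    ConGen.Rel (qrel m) (FreeMonoid.ofList v) (FreeMonoid.ofList w) :=
  Con.eq _

/-- A homomorphism from the monoid of words, given on letters. -/
def qlift {N : Type*} [Monoid N] (φ : X × Bool → N)
    (h : ∀ (x y : X) (k : ℕ) (d d' : Word Bool), Pair m x y k → IsGeodesic (dgen k) d →
      IsGeodesic (dgen k) d' → evalWord (dgen k) d = evalWord (dgen k) d' →
      (d.map fun s => φ (lt x y s)).prod = (d'.map fun s => φ (lt x y s)).prod) : Q m →* N :=
  (conGen (qrel m)).lift (FreeMonoid.lift φ) (by
    apply Con.conGen_le.2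
    rintro _ _ ⟨x, y, k, d, d', P, h1, h2, h3, rfl, rfl⟩
    rw [Con.ker_apply]
    have := h x y k d d' P h1 h2 h3
    simpa [FreeMonoid.lift_apply, Function.comp_def] using this)

lemma qlift_qof {N : Type*} [Monoid N] (φ : X × Bool → N) (h) (s : X × Bool) :
    qlift (m := m) φ h (qof m s) = φ s := by
  unfold qlift qof
  rw [Con.lift_coe]
  simp

lemma isGeodesic_length_eq {G : Type*} [Group G] {f : X → G} {d d' : Word X}
    (h1 : IsGeodesic f d) (h2 : IsGeodesic f d') (h : evalWord f d = evalWord f d') :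
    d.length = d'.length :=
  le_antisymm (h1 _ h.symm) (h2 _ h)

variable (m) in
/-- The length homomorphism. -/
def qlenHom : Q m →* Multiplicative ℕ :=
  qlift (fun _ => Multiplicative.ofAdd 1) (by
    intro x y k d d' _ h1 h2 h3
    simp [isGeodesic_length_eq h1 h2 h3])

/-- The length of an element of the monoid of words. -/
def qlen (q : Q m) : ℕ := (qlenHom m q).toAdd

@[simp] lemma qlen_one : qlen (1 : Q m) = 0 := by simp [qlen]
@[simp] lemma qlen_mul (p q : Q m) : qlen (p * q) = qlen p + qlen q := by simp [qlen]
@[simp] lemma qlen_qof (s : X × Bool) : qlen (qof m s) = 1 := by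
  simp [qlen, qlenHom, qlift_qof]
@[simp] lemma qlen_qw (w : Word X) : qlen (qw m w) = w.length := by
  induction w with
  | nil => simp [qw_nil]
  | cons s w ih => simp [qw_cons, ih, add_comm]

lemma eq_one_of_qlen {q : Q m} (h : qlen q = 0) : q = 1 := by
  obtain ⟨w, rfl⟩ := exists_qw q
  rw [qlen_qw, List.length_eq_zero_iff] at h
  rw [h, qw_nil]

variable (m) in
/-- The canonical section of a dihedral Artin group in the monoid of words. -/
noncomputable def θ (x y : X) (k : ℕ) (g : Dih k) : Q m :=
  qw m ((exists_geodesic (dgg k) g).choose.map (lt x y))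

section Theta

variable {x y : X} {k : ℕ}

@[simp] lemma qlen_θ (g : Dih k) : qlen (θ m x y k g) = wlen (dgen k) g := by
  rw [θ, qlen_qw, List.length_map, (exists_geodesic (dgg k) g).choose_spec.2]

@[simp] lemma θ_one : θ m x y k 1 = 1 :=
  eq_one_of_qlen (by rw [qlen_θ, wlen_one])

lemma θ_evalWord (P : Pair m x y k) {d : Word Bool} (h : IsGeodesic (dgen k) d) :
    θ m x y k (evalWord (dgen k) d) = qw m (d.map (lt x y)) := by
  have hs := (exists_geodesic (dgg k) (evalWord (dgen k) d)).choose_spec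
  unfold θ
  generalize (exists_geodesic (dgg k) (evalWord (dgen k) d)).choose = w at *
  rw [qw_eq_iff]
  refine ConGen.Rel.of _ _ ⟨x, y, k, w, d, P, ?_, h, hs.1, rfl, rfl⟩
  rw [isGeodesic_iff, hs.1, hs.2]

lemma θ_mul (P : Pair m x y k) {g h : Dih k}
    (hl : wlen (dgen k) (g * h) = wlen (dgen k) g + wlen (dgen k) h) :
    θ m x y k (g * h) = θ m x y k g * θ m x y k h := by
  obtain ⟨v, rfl, hv2⟩ := exists_geodesic (dgg k) g
  obtain ⟨w, rfl, hw2⟩ := exists_geodesic (dgg k) h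
  rw [← evalWord_append, θ_evalWord P, θ_evalWord P, θ_evalWord P, List.map_append, qw_append]
  · exact isGeodesic_iff.2 hw2
  · exact isGeodesic_iff.2 hv2
  · rw [isGeodesic_iff, evalWord_append, hl, List.length_append, hv2, hw2]

lemma θ_letterVal (P : Pair m x y k) (s : Bool × Bool) :
    θ m x y k (letterVal (dgen k) s) = qof m (lt x y s) := by
  rw [← evalWord_singleton, θ_evalWord P]
  · rfl
  · rw [isGeodesic_iff, evalWord_singleton, wlen_letterVal (dgg k)]
    rfl

lemma θ_letter_mul (P : Pair m x y k) (s : Bool × Bool) {g : Dih k}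
    (h : wlen (dgen k) (letterVal (dgen k) s * g) = wlen (dgen k) g + 1) :
    θ m x y k (letterVal (dgen k) s * g) = qof m (lt x y s) * θ m x y k g := by
  rw [θ_mul P, θ_letterVal P]
  rw [h, wlen_letterVal (dgg k), add_comm]

lemma θ_desc (P : Pair m x y k) {s : Bool × Bool} {g : Dih k} (h : Desc (dgen k) g s) :
    θ m x y k g = qof m (lt x y s) * θ m x y k ((letterVal (dgen k) s)⁻¹ * g) := by
  rw [desc_iff (dgg k)] at h
  rw [← θ_letter_mul P, mul_inv_cancel_left]
  rw [mul_inv_cancel_left, h]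

lemma θ_swap (A : Adm m) (P : Pair m x y k) (g : Dih k) :
    θ m y x k (dswap k g) = θ m x y k g := by
  obtain ⟨w, rfl, hw2⟩ := exists_geodesic (dgg k) g
  rw [θ_evalWord P (isGeodesic_iff.2 hw2), dswap_evalWord, θ_evalWord (P.symm A)]
  · rw [List.map_map]
    congr 1
    apply List.map_congr_left
    intro s _
    exact lt_swap x y s
  · rw [isGeodesic_iff, ← dswap_evalWord, wlen_dswap, List.length_map, hw2]

end Theta

/-- Two factorisations of an element differing by a dihedral rewriting at the front. -/
def Step (a b : (X × Bool) × Q m) : Prop :=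
  ∃ (x y : X) (k : ℕ) (g : Dih k) (s t : Bool × Bool) (v : Q m), Pair m x y k ∧
    Desc (dgen k) g s ∧ Desc (dgen k) g t ∧
    a = (lt x y s, θ m x y k ((letterVal (dgen k) s)⁻¹ * g) * v) ∧
    b = (lt x y t, θ m x y k ((letterVal (dgen k) t)⁻¹ * g) * v)

lemma Step.symm {a b : (X × Bool) × Q m} (h : Step a b) : Step b a := by
  obtain ⟨x, y, k, g, s, t, v, P, h1, h2, h3, h4⟩ := h
  exact ⟨x, y, k, g, t, s, v, P, h2, h1, h4, h3⟩

lemma Step.mul_right {a b : (X × Bool) × Q m} (h : Step a b) (z : Q m) :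
    Step (a.1, a.2 * z) (b.1, b.2 * z) := by
  obtain ⟨x, y, k, g, s, t, v, P, h1, h2, rfl, rfl⟩ := h
  exact ⟨x, y, k, g, s, t, v * z, P, h1, h2, by simp [mul_assoc], by simp [mul_assoc]⟩

lemma Step.eq {a b : (X × Bool) × Q m} (h : Step a b) :
    qof m a.1 * a.2 = qof m b.1 * b.2 := by
  obtain ⟨x, y, k, g, s, t, v, P, h1, h2, rfl, rfl⟩ := h
  simp only
  rw [← mul_assoc, ← mul_assoc, ← θ_desc P h1, ← θ_desc P h2]

lemma eqvGen_step_mul_right {a b : (X × Bool) × Q m} (h : Relation.EqvGen Step a b) (z : Q m) :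
    Relation.EqvGen Step (a.1, a.2 * z) (b.1, b.2 * z) := by
  induction h with
  | rel a b h => exact .rel _ _ (h.mul_right z)
  | refl a => exact .refl _
  | symm a b _ ih => exact .symm _ _ ih
  | trans a b c _ _ ih1 ih2 => exact .trans _ _ _ ih1 ih2

lemma desc_of_geodesic_cons {G : Type*} [Group G] {f : X → G} {s : X × Bool} {w : Word X}
    (h : IsGeodesic f (s :: w)) : Desc f (evalWord f (s :: w)) s := by
  rw [Desc, ← isGeodesic_iff.1 h, evalWord_cons, inv_mul_cancel_left,
    ← isGeodesic_iff.1 (isGeodesic_tail h)]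
  simp

lemma chain_aux {v w : FreeMonoid (X × Bool)} (h : ConGen.Rel (qrel m) v w) :
    (v.toList = [] ↔ w.toList = []) ∧ ∀ s v' t w', v.toList = s :: v' → w.toList = t :: w' →
      Relation.EqvGen Step (s, qw m v') (t, qw m w') := by
  induction h with
  | of v w h =>
    obtain ⟨x, y, k, d, d', P, h1, h2, h3, rfl, rfl⟩ := h
    have hl := isGeodesic_length_eq h1 h2 h3
    simp only [FreeMonoid.toList_ofList, List.map_eq_nil_iff]
    refine ⟨by rw [← List.length_eq_zero_iff, hl, List.length_eq_zero_iff], ?_⟩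
    intro s v' t w' hs ht
    obtain ⟨s, d, rfl, rfl, rfl⟩ := List.map_eq_cons_iff.1 hs
    obtain ⟨t, d', rfl, rfl, rfl⟩ := List.map_eq_cons_iff.1 ht
    refine .rel _ _ ⟨x, y, k, _, s, t, 1, P, desc_of_geodesic_cons h1,
      h3 ▸ desc_of_geodesic_cons h2, ?_, ?_⟩
    · rw [evalWord_cons, inv_mul_cancel_left, θ_evalWord P (isGeodesic_tail h1), mul_one]
    · rw [h3, evalWord_cons, inv_mul_cancel_left, θ_evalWord P (isGeodesic_tail h2), mul_one]
  | refl v =>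
    refine ⟨Iff.rfl, fun s v' t w' h1 h2 => ?_⟩
    rw [h1, List.cons.injEq] at h2
    rw [h2.1, h2.2]
    exact .refl _
  | symm _ ih =>
    exact ⟨ih.1.symm, fun s v' t w' h1 h2 => .symm _ _ (ih.2 t w' s v' h2 h1)⟩
  | @trans a b c _ _ ih1 ih2 =>
    refine ⟨ih1.1.trans ih2.1, fun s v' t w' h1 h2 => ?_⟩
    cases hb : b.toList with
    | nil => rw [ih1.1.2 hb] at h1; simp at h1
    | cons r u => exact .trans _ _ _ (ih1.2 s v' r u h1 hb) (ih2.2 r u t w' hb h2)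
  | @mul a b c d hab hcd ih1 ih2 =>
    simp only [FreeMonoid.toList_mul, List.append_eq_nil_iff]
    refine ⟨and_congr ih1.1 ih2.1, fun s v' t w' h1 h2 => ?_⟩
    cases ha : a.toList with
    | nil =>
      have hb := ih1.1.1 ha
      rw [ha, List.nil_append] at h1
      rw [hb, List.nil_append] at h2
      exact ih2.2 s v' t w' h1 h2
    | cons r u =>
      cases hb : b.toList with
      | nil => rw [ih1.1.2 hb] at ha; simp at ha
      | cons r' u' =>
        rw [ha, List.cons_append, List.cons.injEq] at h1
        rw [hb, List.cons_append, List.cons.injEq] at h2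
        have h3 := eqvGen_step_mul_right (ih1.2 r u r' u' ha hb) (qw m c.toList)
        have h4 : qw m c.toList = qw m d.toList := qw_eq_iff.2 hcd
        rw [← h1.1, ← h1.2, ← h2.1, ← h2.2, qw_append, qw_append, ← h4]
        exact h3

lemma chain {s t : X × Bool} {u u' : Q m} (h : qof m s * u = qof m t * u') :
    Relation.EqvGen Step (s, u) (t, u') := by
  obtain ⟨v, rfl⟩ := exists_qw u
  obtain ⟨w, rfl⟩ := exists_qw u'
  rw [← qw_cons, ← qw_cons, qw_eq_iff] at h
  exact (chain_aux h).2 s v t w rfl rfl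

/-- Factorisations which are equal or differ by one dihedral rewriting. -/
def Coh (s : X × Bool) (u : Q m) (t : X × Bool) (u' : Q m) : Prop :=
  (s = t ∧ u = u') ∨ Step (s, u) (t, u')

lemma Coh.symm {s t : X × Bool} {u u' : Q m} (h : Coh s u t u') : Coh t u' s u := by
  rcases h with ⟨rfl, rfl⟩ | h
  exacts [Or.inl ⟨rfl, rfl⟩, Or.inr h.symm]

lemma Coh.refl (s : X × Bool) (u : Q m) : Coh s u s u := Or.inl ⟨rfl, rfl⟩

lemma Coh.eq {s t : X × Bool} {u u' : Q m} (h : Coh s u t u') : qof m s * u = qof m t * u' := by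
  rcases h with ⟨rfl, rfl⟩ | h
  exacts [rfl, h.eq]

lemma coh_of {x y : X} {k : ℕ} (P : Pair m x y k) {g : Dih k} {s t : Bool × Bool} {v : Q m}
    (hs : Desc (dgen k) g s) (ht : Desc (dgen k) g t) :
    Coh (lt x y s) (θ m x y k ((letterVal (dgen k) s)⁻¹ * g) * v)
      (lt x y t) (θ m x y k ((letterVal (dgen k) t)⁻¹ * g) * v) :=
  Or.inr ⟨x, y, k, g, s, t, v, P, hs, ht, rfl, rfl⟩

lemma Coh.same (A : Adm m) {s t : X × Bool} {u u' : Q m} (h : Coh s u t u') (hst : s.1 = t.1) :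
    s = t ∧ u = u' := by
  rcases h with h | ⟨x, y, k, g, s', t', v, P, h1, h2, h3, h4⟩
  · exact h
  rw [Prod.mk.injEq] at h3 h4
  obtain ⟨rfl, rfl⟩ := h3
  obtain ⟨rfl, rfl⟩ := h4
  have : s'.1 = t'.1 := by
    by_contra hne
    exact P.lt_fst_ne hne hst
  rcases eq_or_eq_letterInv this with rfl | rfl
  · exact ⟨rfl, rfl⟩
  · exact absurd h1 (dih_not_desc_both (P.two_le A) g t' h2)

lemma Coh.ne (A : Adm m) {s t : X × Bool} {u u' : Q m} (h : Coh s u t u') (hst : s.1 ≠ t.1) :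
    ∃ k, Pair m s.1 t.1 k ∧ ∃ (g : Dih k) (v : Q m), Desc (dgen k) g (true, s.2) ∧
      Desc (dgen k) g (false, t.2) ∧
      u = θ m s.1 t.1 k ((letterVal (dgen k) (true, s.2))⁻¹ * g) * v ∧
      u' = θ m s.1 t.1 k ((letterVal (dgen k) (false, t.2))⁻¹ * g) * v := by
  rcases h with h | ⟨x, y, k, g, s', t', v, P, h1, h2, h3, h4⟩
  · exact absurd (congrArg Prod.fst h.1) hst
  rw [Prod.mk.injEq] at h3 h4
  obtain ⟨rfl, rfl⟩ := h3
  obtain ⟨rfl, rfl⟩ := h4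
  obtain ⟨b, c⟩ := s'
  obtain ⟨b', c'⟩ := t'
  cases b <;> cases b'
  · exact absurd rfl hst
  · refine ⟨k, P.symm A, dswap k g, v, desc_dswap.2 h1, desc_dswap.2 h2, ?_, ?_⟩
    · show _ = θ m y x k _ * v
      rw [← θ_swap A P, map_mul, map_inv, dswap_letterVal]
      rfl
    · show _ = θ m y x k _ * v
      rw [← θ_swap A P, map_mul, map_inv, dswap_letterVal]
      rfl
  · exact ⟨k, P, g, v, h1, h2, rfl, rfl⟩
  · exact absurd rfl hst

lemma Coh.pair (A : Adm m) {x y : X} {k : ℕ} (P : Pair m x y k) {s t : Bool × Bool} {u u' : Q m}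
    (h : Coh (lt x y s) u (lt x y t) u') (hst : s.1 ≠ t.1) :
    ∃ (g : Dih k) (v : Q m), Desc (dgen k) g s ∧ Desc (dgen k) g t ∧
      u = θ m x y k ((letterVal (dgen k) s)⁻¹ * g) * v ∧
      u' = θ m x y k ((letterVal (dgen k) t)⁻¹ * g) * v := by
  obtain ⟨k', P', g, v, h1, h2, h3, h4⟩ := h.ne A (P.lt_fst_ne hst)
  obtain ⟨b, c⟩ := s
  obtain ⟨b', c'⟩ := t
  cases b <;> cases b'
  · exact absurd rfl hst
  · have P'' : Pair m x y k' := P'.symm A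
    obtain rfl := P.eq P''
    refine ⟨dswap k g, v, desc_dswap.2 h1, desc_dswap.2 h2, ?_, ?_⟩
    · rw [h3]
      show θ m y x k _ * v = _
      rw [← θ_swap A (P.symm A), map_mul, map_inv, dswap_letterVal]
      rfl
    · rw [h4]
      show θ m y x k _ * v = _
      rw [← θ_swap A (P.symm A), map_mul, map_inv, dswap_letterVal]
      rfl
  · have P'' : Pair m x y k' := P'
    obtain rfl := P.eq P''
    exact ⟨g, v, h1, h2, h3, h4⟩
  · exact absurd rfl hst

end ThreeFreeArtin

namespace ThreeFreeArtin

variable {X : Type*} {m : X → X → ℕ∞}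

/-- Classes of words in which no cancellation is possible after rewriting. -/
def Irr (q : Q m) : Prop := ∀ p s r, q ≠ p * qof m s * qof m (letterInv s) * r

lemma Irr.left {a b : Q m} (h : Irr (a * b)) : Irr a := by
  rintro p s r rfl
  exact h p s (r * b) (by simp only [mul_assoc])

lemma Irr.right {a b : Q m} (h : Irr (a * b)) : Irr b := by
  rintro p s r rfl
  exact h (a * p) s r (by simp only [mul_assoc])

/-- Some letter of type `x` is a left divisor of `q`. -/
def T (x : X) (q : Q m) : Prop := ∃ b u, q = qof m (x, b) * u

/-- No letter of type `x` or `y` is a left divisor of `v`. -/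
def Gate (x y : X) (v : Q m) : Prop := ¬ T x v ∧ ¬ T y v

lemma Gate.not_T {x y : X} {v : Q m} (h : Gate x y v) (β : Bool) : ¬ T (pr x y β) v := by
  cases β
  exacts [h.2, h.1]

section Dihedral

variable {x y : X} {k : ℕ}

lemma wlen_mul_of_irr (P : Pair m x y k) {h' : Dih k} :
    ∀ (n : ℕ) (h : Dih k), wlen (dgen k) h = n → Irr (θ m x y k h * θ m x y k h') →
      wlen (dgen k) (h * h') = wlen (dgen k) h + wlen (dgen k) h' := by
  intro n
  induction n with
  | zero =>
    intro h hn _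
    rw [wlen_eq_zero (dgg k)] at hn
    subst hn
    simp [wlen_one]
  | succ n ih =>
    intro h hn hI
    have h1 : h ≠ 1 := by
      rintro rfl
      rw [wlen_one] at hn
      omega
    obtain ⟨s, hs⟩ := exists_desc (dgg k) h1
    have hI' := hI
    rw [θ_desc P hs, mul_assoc] at hI
    rw [desc_iff (dgg k)] at hs
    have h2 := ih ((letterVal (dgen k) s)⁻¹ * h) (by omega) hI.right
    by_cases h3 : Desc (dgen k) ((letterVal (dgen k) s)⁻¹ * h * h') (letterInv s)
    · rw [← θ_mul P h2, θ_desc P h3, lt_letterInv] at hI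
      rw [← mul_assoc, ← one_mul (qof m (lt x y s))] at hI
      exact (hI _ _ _ rfl).elim
    · rw [not_desc_iff (dgg k)] at h3
      simp only [letterVal_letterInv, inv_inv, mul_assoc, mul_inv_cancel_left] at h3 h2
      omega

lemma exists_gate (P : Pair m x y k) :
    ∀ (n : ℕ) (q : Q m), qlen q = n → Irr q →
      ∃ (g : Dih k) (v : Q m), q = θ m x y k g * v ∧ Gate x y v := by
  intro n
  induction n with
  | zero =>
    intro q hq _
    refine ⟨1, q, by simp, ?_, ?_⟩ <;> rintro ⟨b, u, rfl⟩ <;> simp at hq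
  | succ n ih =>
    intro q hq hI
    by_cases hG : Gate x y q
    · exact ⟨1, q, by simp, hG⟩
    have : ∃ s u, q = qof m (lt x y s) * u := by
      rw [Gate, not_and_or, not_not, not_not] at hG
      rcases hG with ⟨b, u, h⟩ | ⟨b, u, h⟩
      exacts [⟨(true, b), u, h⟩, ⟨(false, b), u, h⟩]
    obtain ⟨s, u, rfl⟩ := this
    obtain ⟨g, v, rfl, hv⟩ := ih u (by simp at hq; omega) hI.right
    refine ⟨letterVal (dgen k) s * g, v, ?_, hv⟩
    rw [← mul_assoc, ← θ_letterVal P] at hI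
    rw [θ_mul P (wlen_mul_of_irr P _ _ rfl hI.left), θ_letterVal P, mul_assoc]

end Dihedral

variable (m) in
/-- Any two factorisations of an irreducible element of length at most `n` differ by a single
dihedral rewriting at the front. -/
def HP (n : ℕ) : Prop :=
  ∀ s u t u', Irr (qof m s * u) → qlen u + 1 ≤ n → qof m s * u = qof m t * u' → Coh s u t u'

lemma HP.mono {n n' : ℕ} (H : HP m n) (h : n' ≤ n) : HP m n' :=
  fun s u t u' h1 h2 h3 => H s u t u' h1 (h2.trans h) h3

section Division

variable {x y : X} {k n : ℕ}

lemma gate_div (A : Adm m) (H : HP m n) (P : Pair m x y k) :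
    ∀ (N : ℕ) (g h : Dih k) (v v' : Q m), N ≤ n → qlen (θ m x y k g * v) = N →
      Irr (θ m x y k g * v) → Gate x y v → θ m x y k g * v = θ m x y k h * v' →
      ∃ k', g = h * k' ∧ wlen (dgen k) g = wlen (dgen k) h + wlen (dgen k) k' ∧
        v' = θ m x y k k' * v := by
  intro N
  induction N with
  | zero =>
    intro g h v v' _ hl _ hG he
    have h1 : qlen (θ m x y k h * v') = 0 := by rw [← he, hl]
    simp only [qlen_mul, qlen_θ, Nat.add_eq_zero_iff, wlen_eq_zero (dgg k)] at h1
    obtain ⟨rfl, -⟩ := h1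
    exact ⟨g, by simp, by simp [wlen_one], by rw [he]; simp⟩
  | succ N ih =>
    intro g h v v' hN hl hI hG he
    by_cases h1 : h = 1
    · subst h1
      exact ⟨g, by simp, by simp [wlen_one], by rw [he]; simp⟩
    obtain ⟨s, hs⟩ := exists_desc (dgg k) h1
    rw [θ_desc P hs, mul_assoc] at he
    generalize hu : θ m x y k ((letterVal (dgen k) s)⁻¹ * h) * v' = u at he
    have key : Desc (dgen k) g s ∧ u = θ m x y k ((letterVal (dgen k) s)⁻¹ * g) * v := by
      by_cases hg : g = 1
      · subst hg
        refine absurd ?_ (hG.not_T s.1)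
        rw [θ_one, one_mul] at he
        exact ⟨s.2, u, he⟩
      obtain ⟨t, ht⟩ := exists_desc (dgg k) hg
      have ht' := (desc_iff (dgg k)).1 ht
      have hI' := hI
      rw [θ_desc P ht, mul_assoc] at he hI'
      rw [θ_desc P ht, mul_assoc, qlen_mul, qlen_qof] at hl
      have hc := H _ _ _ _ hI' (by omega) he
      by_cases hst : t.1 = s.1
      · obtain ⟨h2, h3⟩ := hc.same A (by simp [lt, hst])
        obtain rfl := P.lt_inj h2
        exact ⟨ht, h3.symm⟩
      · obtain ⟨g', v'', h2, h3, h4, h5⟩ := hc.pair A P hst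
        obtain ⟨k', h6, h7, h8⟩ := ih _ _ _ _ (by omega) (by omega) hI'.right hG h4
        rw [mul_assoc] at h6
        have h6' := mul_left_cancel h6
        rw [desc_iff (dgg k)] at h2
        have h3' := h3
        rw [desc_iff (dgg k)] at h3
        have h9 := wlen_mul_le (dgg k) ((letterVal (dgen k) s)⁻¹ * g') k'
        rw [mul_assoc, ← h6'] at h9
        have h10 : Desc (dgen k) g s := by
          rw [Desc]
          omega
        refine ⟨h10, ?_⟩
        rw [desc_iff (dgg k)] at h10
        rw [h5, h8, ← mul_assoc, ← θ_mul P, mul_assoc, ← h6']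
        rw [mul_assoc, ← h6']
        omega
    obtain ⟨h2, h3⟩ := key
    have hs' := (desc_iff (dgg k)).1 hs
    have h2' := (desc_iff (dgg k)).1 h2
    have hI' := hI
    rw [θ_desc P h2, mul_assoc] at hI'
    rw [θ_desc P h2, mul_assoc, qlen_mul, qlen_qof] at hl
    obtain ⟨k', h4, h5, h6⟩ := ih _ _ _ _ (by omega) (by omega) hI'.right hG (h3.symm.trans hu.symm)
    rw [mul_assoc] at h4
    exact ⟨k', mul_left_cancel h4, by omega, h6⟩

lemma gate_letter (A : Adm m) (H : HP m n) (P : Pair m x y k) {g : Dih k} {v u : Q m}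
    {s : Bool × Bool} (hn : qlen (θ m x y k g * v) ≤ n) (hI : Irr (θ m x y k g * v))
    (hG : Gate x y v) (he : θ m x y k g * v = qof m (lt x y s) * u) :
    Desc (dgen k) g s ∧ u = θ m x y k ((letterVal (dgen k) s)⁻¹ * g) * v := by
  rw [← θ_letterVal P] at he
  obtain ⟨k', rfl, h1, h2⟩ := gate_div A H P _ _ _ _ _ hn rfl hI hG he
  rw [wlen_letterVal (dgg k)] at h1
  refine ⟨?_, by simpa using h2⟩
  rw [Desc, inv_mul_cancel_left]
  omega

lemma gate_T_iff (A : Adm m) (H : HP m n) (P : Pair m x y k) {g : Dih k} {v : Q m}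
    (hn : qlen (θ m x y k g * v) ≤ n) (hI : Irr (θ m x y k g * v))
    (hG : Gate x y v) (β : Bool) :
    T (pr x y β) (θ m x y k g * v) ↔ ∃ b, Desc (dgen k) g (β, b) := by
  constructor
  · rintro ⟨b, u, h⟩
    exact ⟨b, (gate_letter A H P (s := (β, b)) hn hI hG h).1⟩
  · rintro ⟨b, h⟩
    exact ⟨b, _, by rw [θ_desc P h, mul_assoc]; rfl⟩

end Division

variable (m) in
/-- Prepending a noncancelling letter preserves irreducibility up to length `n`. -/
def IrrCons (n : ℕ) : Prop :=
  ∀ s u, Irr u → qlen u ≤ n → (∀ u', u ≠ qof m (letterInv s) * u') → Irr (qof m s * u)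

variable (m) in
/-- Prepending a dihedral element to a gate preserves irreducibility up to length `n`. -/
def IrrGate (n : ℕ) : Prop :=
  ∀ (x y : X) (k : ℕ) (_ : Pair m x y k) (g : Dih k) (v : Q m), Irr v → Gate x y v →
    qlen (θ m x y k g * v) ≤ n → Irr (θ m x y k g * v)

lemma irrGate_zero : IrrGate m 0 := by
  intro x y k P g v hv _ hl
  simp only [qlen_mul, qlen_θ, Nat.le_zero, Nat.add_eq_zero_iff, wlen_eq_zero (dgg k)] at hl
  rw [hl.1, θ_one, one_mul]
  exact hv

lemma irrGate_succ (A : Adm m) {n : ℕ} (H : HP m n) (hc : IrrCons m n) : IrrGate m (n + 1) := by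
  intro x y k P g v hv hG hl
  generalize hN : wlen (dgen k) g = N
  induction N generalizing g with
  | zero =>
    rw [wlen_eq_zero (dgg k)] at hN
    rw [hN, θ_one, one_mul]
    exact hv
  | succ N ih =>
    have h1 : g ≠ 1 := by
      rintro rfl
      rw [wlen_one] at hN
      omega
    obtain ⟨s, hs⟩ := exists_desc (dgg k) h1
    have hs' := (desc_iff (dgg k)).1 hs
    rw [θ_desc P hs, mul_assoc] at hl ⊢
    have hl' : qlen (θ m x y k ((letterVal (dgen k) s)⁻¹ * g) * v) ≤ n := by
      rw [qlen_mul, qlen_qof] at hl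
      omega
    have hI := ih ((letterVal (dgen k) s)⁻¹ * g) (by omega) (by omega)
    refine hc _ _ hI hl' ?_
    intro u' hu'
    have := (gate_letter A H P (s := letterInv s) hl' hI hG hu').1
    rw [Desc, letterVal_letterInv, inv_inv, mul_inv_cancel_left] at this
    omega

/-- A factorisation of length at most `n + 1` whose first letter does not cancel. -/
def Good (n : ℕ) (a : (X × Bool) × Q m) : Prop :=
  Irr a.2 ∧ qlen a.2 ≤ n ∧ ∀ u', a.2 ≠ qof m (letterInv a.1) * u'

lemma Good.step (A : Adm m) {n : ℕ} (H : HP m n) (hg : IrrGate m n) {a b : (X × Bool) × Q m}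
    (h : Good n a) (hs : Step a b) : Good n b := by
  obtain ⟨x, y, k, g, s, t, v, P, h1, h2, rfl, rfl⟩ := hs
  obtain ⟨hI, hl, hu⟩ := h
  dsimp only at hI hl hu
  have h1' := (desc_iff (dgg k)).1 h1
  have h2' := (desc_iff (dgg k)).1 h2
  obtain ⟨k', v0, rfl, hG⟩ := exists_gate P _ _ rfl hI.right
  rw [← mul_assoc] at hI hl hu
  have h3 := wlen_mul_of_irr P _ _ rfl hI.left
  rw [← θ_mul P h3] at hI hl hu
  rw [mul_assoc] at h3
  have h4 : wlen (dgen k) (g * k') = wlen (dgen k) g + wlen (dgen k) k' := by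
    by_contra hne
    have h5 := wlen_letter_mul (dgg k) s ((letterVal (dgen k) s)⁻¹ * (g * k'))
    rw [mul_inv_cancel_left] at h5
    have h6 : Desc (dgen k) ((letterVal (dgen k) s)⁻¹ * (g * k')) (letterInv s) := by
      rw [Desc, letterVal_letterInv, inv_inv, mul_inv_cancel_left]
      omega
    rw [mul_assoc, θ_desc P h6, mul_assoc, lt_letterInv] at hu
    exact hu _ rfl
  have h5 := wlen_letter_mul (dgg k) t ((letterVal (dgen k) t)⁻¹ * (g * k'))
  rw [mul_inv_cancel_left] at h5
  have h6 := wlen_mul_le (dgg k) ((letterVal (dgen k) t)⁻¹ * g) k'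
  rw [mul_assoc] at h6
  have h7 : wlen (dgen k) ((letterVal (dgen k) t)⁻¹ * (g * k')) =
      wlen (dgen k) ((letterVal (dgen k) t)⁻¹ * g) + wlen (dgen k) k' := by omega
  have h8 : θ m x y k ((letterVal (dgen k) t)⁻¹ * g) * (θ m x y k k' * v0) =
      θ m x y k ((letterVal (dgen k) t)⁻¹ * (g * k')) * v0 := by
    rw [← mul_assoc, ← θ_mul P, mul_assoc]
    rw [mul_assoc, h7]
  have hl2 : qlen (θ m x y k ((letterVal (dgen k) t)⁻¹ * (g * k')) * v0) ≤ n := by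
    simp only [qlen_mul, qlen_θ, mul_assoc] at hl ⊢
    omega
  have hI2 := hg x y k P _ v0 hI.right hG hl2
  unfold Good
  dsimp only
  rw [h8]
  refine ⟨hI2, hl2, fun u' hu' => ?_⟩
  have := (gate_letter A H P (s := letterInv t) hl2 hI2 hG hu').1
  rw [Desc, letterVal_letterInv, inv_inv, mul_inv_cancel_left] at this
  omega

lemma irrCons_of_irrGate (A : Adm m) {n : ℕ} (H : HP m n) (hg : IrrGate m n) : IrrCons m n := by
  intro s u hI hl hu p t r he
  have key : ∀ a b : (X × Bool) × Q m, Relation.EqvGen Step a b → (Good n a ↔ Good n b) := by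
    intro a b h
    induction h with
    | rel a b h => exact ⟨fun h' => h'.step A H hg h, fun h' => h'.step A H hg h.symm⟩
    | refl a => exact Iff.rfl
    | symm a b _ ih => exact ih.symm
    | trans a b c _ _ ih1 ih2 => exact ih1.trans ih2
  obtain ⟨w, rfl⟩ := exists_qw p
  cases w with
  | nil =>
    rw [qw_nil, one_mul, mul_assoc] at he
    exact ((key _ _ (chain he)).1 ⟨hI, hl, hu⟩).2.2 _ rfl
  | cons c w =>
    rw [qw_cons, mul_assoc, mul_assoc, mul_assoc] at he
    exact ((key _ _ (chain he)).1 ⟨hI, hl, hu⟩).1 (qw m w) t r (by simp only [mul_assoc])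

lemma irrGate_and_irrCons (A : Adm m) : ∀ {n : ℕ}, HP m n → IrrGate m n ∧ IrrCons m n
  | 0, H => ⟨irrGate_zero, irrCons_of_irrGate A H irrGate_zero⟩
  | _ + 1, H =>
    have h := irrGate_succ A (H.mono (Nat.le_succ _))
      (irrGate_and_irrCons A (H.mono (Nat.le_succ _))).2
    ⟨h, irrCons_of_irrGate A H h⟩

end ThreeFreeArtin

namespace ThreeFreeArtin

variable {X : Type*} {m : X → X → ℕ∞}

/-- `Strip x q q'`: removing from `q` all left divisors of type `x` can result in `q'`. -/
inductive Strip (x : X) : Q m → Q m → Prop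
  | done (q : Q m) : ¬ T x q → Strip x q q
  | step (b : Bool) (u q' : Q m) : Strip x u q' → Strip x (qof m (x, b) * u) q'

lemma Strip.not_T {x : X} {q q' : Q m} (h : Strip x q q') : ¬ T x q' := by
  induction h with
  | done q h => exact h
  | step _ _ _ _ ih => exact ih

lemma Strip.exists_eq {x : X} {q q' : Q m} (h : Strip x q q') : ∃ p, q = p * q' := by
  induction h with
  | done q h => exact ⟨1, by simp⟩
  | step b _ _ _ ih =>
    obtain ⟨p, rfl⟩ := ih
    exact ⟨qof m (x, b) * p, by rw [mul_assoc]⟩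

lemma Strip.irr {x : X} {q q' : Q m} (h : Strip x q q') (hI : Irr q) : Irr q' := by
  obtain ⟨p, rfl⟩ := h.exists_eq
  exact hI.right

lemma Strip.qlen_le {x : X} {q q' : Q m} (h : Strip x q q') : qlen q' ≤ qlen q := by
  obtain ⟨p, rfl⟩ := h.exists_eq
  simp

lemma Strip.qlen_lt {x : X} {q q' : Q m} (h : Strip x q q') (hT : T x q) : qlen q' < qlen q := by
  cases h with
  | done _ h => exact absurd hT h
  | step b u _ h =>
    have := h.qlen_le
    simp
    omega

lemma exists_strip (x : X) : ∀ (n : ℕ) (q : Q m), qlen q = n → ∃ q', Strip x q q' := by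
  intro n
  induction n with
  | zero =>
    intro q hq
    refine ⟨q, .done _ ?_⟩
    rintro ⟨b, u, rfl⟩
    simp at hq
  | succ n ih =>
    intro q hq
    by_cases hT : T x q
    · obtain ⟨b, u, rfl⟩ := hT
      obtain ⟨q', h⟩ := ih u (by simp at hq; omega)
      exact ⟨q', .step b u q' h⟩
    · exact ⟨q, .done _ hT⟩

/-- The result of removing from `q` all left divisors of type `x`. -/
noncomputable def strip (x : X) (q : Q m) : Q m := (exists_strip x _ q rfl).choose

lemma strip_spec (x : X) (q : Q m) : Strip x q (strip x q) := (exists_strip x _ q rfl).choose_spec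

lemma irr_strip {x : X} {q : Q m} (h : Irr q) : Irr (strip x q) := (strip_spec x q).irr h

lemma qlen_strip_le (x : X) (q : Q m) : qlen (strip x q) ≤ qlen q := (strip_spec x q).qlen_le

variable {n : ℕ}

lemma Strip.unique (A : Adm m) (H : HP m n) {x : X} {q q' : Q m} (h : Strip x q q') (hI : Irr q)
    (hn : qlen q ≤ n) : ∀ {q''}, Strip x q q'' → q' = q'' := by
  induction h with
  | done q h =>
    intro q'' h'
    cases h' with
    | done _ h => rfl
    | step b u _ h' => exact absurd ⟨b, u, rfl⟩ h
  | step b u q' h ih =>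
    have key : ∀ p q'', Strip x p q'' → p = qof m (x, b) * u → q' = q'' := by
      rintro p q'' (⟨_, h'⟩ | ⟨b', u', _, h'⟩) he
      · exact absurd ⟨b, u, he⟩ h'
      · have := (H _ _ _ _ hI (by simp at hn; omega) he.symm).same A rfl
        rw [← this.2] at h'
        exact ih hI.right (by simp at hn; omega) h'
    intro q'' h'
    exact key _ _ h' rfl

lemma Strip.eq_strip (A : Adm m) (H : HP m n) {x : X} {q q' : Q m} (h : Strip x q q') (hI : Irr q)
    (hn : qlen q ≤ n) : strip x q = q' :=
  (strip_spec x q).unique A H hI hn h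

section Core

variable {x y : X} {k : ℕ}

lemma strip_gate (A : Adm m) (H : HP m n) (P : Pair m x y k) (β : Bool) {v : Q m}
    (hG : Gate x y v) {q q' : Q m} (h : Strip (pr x y β) q q') (hI : Irr q) (hn : qlen q ≤ n)
    {e : Dih k} (he : q = θ m x y k e * v) :
    ∃ p : ℤ, q' = θ m x y k (dgen k β ^ p * e) * v := by
  induction h generalizing e with
  | done q h => exact ⟨0, by simpa using he⟩
  | step b u q' h ih =>
    have hI' := hI
    rw [he] at hI hn
    have h1 := (gate_letter A H P (s := (β, b)) hn hI hG he.symm).2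
    rw [← he] at hn
    obtain ⟨p, hp⟩ := ih hI'.right (by simp at hn; omega) h1
    refine ⟨if b then p - 1 else p + 1, ?_⟩
    rw [hp, ← mul_assoc (dgen k β ^ p)]
    congr 3
    cases b <;> simp [letterVal, zpow_add_one, zpow_sub_one]

/-- The element `q` is obtained from an element divisible by letters of type `x` and of type `y`
by multiplication by a power of `x`. -/
def Crit (x y : X) (q : Q m) : Prop :=
  ∃ k, Pair m x y k ∧ ∃ (c : Dih k) (p : ℤ) (v : Q m) (b b' : Bool), Gate x y v ∧
    Desc (dgen k) c (true, b) ∧ Desc (dgen k) c (false, b') ∧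
    q = θ m x y k (dgen k true ^ p * c) * v

lemma gate_eq_one (A : Adm m) (H : HP m n) (P : Pair m x y k) {e : Dih k} {v : Q m}
    (hI : Irr (θ m x y k e * v)) (hn : qlen (θ m x y k e * v) ≤ n) (hG : Gate x y v)
    (hx : ¬ T x (θ m x y k e * v)) (hy : ¬ T y (θ m x y k e * v)) : e = 1 := by
  by_contra h
  obtain ⟨⟨β, b⟩, hs⟩ := exists_desc (dgg k) h
  have := (gate_T_iff A H P hn hI hG β).2 ⟨b, hs⟩
  cases β
  exacts [hy this, hx this]

lemma Crit.T_strip (A : Adm m) (H : HP m n) {q : Q m} (h : Crit x y q) (hI : Irr q)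
    (hn : qlen q ≤ n) : T y (strip x q) := by
  obtain ⟨k, P, c, p, v, b, b', hG, h1, h2, h3⟩ := h
  by_contra hT
  have hI' := irr_strip (x := x) hI
  have hn' := (qlen_strip_le x q).trans hn
  have hx := (strip_spec x q).not_T
  obtain ⟨r, hr⟩ := strip_gate A H P true hG (strip_spec x q) hI hn h3
  rw [hr] at hI' hn' hT hx
  have := gate_eq_one A H P hI' hn' hG hx hT
  rw [← mul_assoc, ← zpow_add, mul_eq_one_iff_inv_eq, ← zpow_neg] at this
  rw [← this] at h2
  exact dih_zpow_not_desc (P.two_le A) true _ b' h2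

lemma Pair.four_le (A : Adm m) (P : Pair m x y k) (hm : m x y ≠ 2) : 4 ≤ k := by
  have h1 := P.two_le A
  have h2 := P.ne_three A
  have h3 : k ≠ 2 := by
    rintro rfl
    exact hm P.lab
  omega

lemma Crit.T_strip_strip (A : Adm m) (H : HP m n) {q : Q m} (h : Crit x y q) (hI : Irr q)
    (hn : qlen q ≤ n) (hm : m x y ≠ 2) : T x (strip y (strip x q)) := by
  obtain ⟨k, P, c, p, v, b, b', hG, h1, h2, h3⟩ := h
  by_contra hT
  have hI' := irr_strip (x := x) hI
  have hn' := (qlen_strip_le x q).trans hn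
  have hI2 := irr_strip (x := y) hI'
  have hn2 := (qlen_strip_le y _).trans hn'
  have hx := (strip_spec y (strip x q)).not_T
  obtain ⟨r, hr⟩ := strip_gate A H P true hG (strip_spec x q) hI hn h3
  obtain ⟨s, hs⟩ := strip_gate A H P false hG (strip_spec y (strip x q)) hI' hn' hr
  rw [hs] at hI2 hn2 hT hx
  have := gate_eq_one A H P hI2 hn2 hG hT hx
  rw [← mul_assoc (dgen k true ^ r), ← zpow_add, ← mul_assoc, mul_eq_one_iff_inv_eq, mul_inv_rev,
    ← zpow_neg, ← zpow_neg] at this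
  have h4 := dih_three_syllables (P.two_le A) (P.four_le A hm) true (-(r + p)) (-s) 0 b b'
  simp only [Bool.not_true, zpow_zero, mul_one] at h4
  rw [this] at h4
  exact h4 h1 h2

lemma Crit.T_strip_strip_strip (A : Adm m) (H : HP m n) {q : Q m} (h : Crit x y q) (hI : Irr q)
    (hn : qlen q ≤ n) (hm : m x y ≠ 2) : T y (strip x (strip y (strip x q))) := by
  obtain ⟨k, P, c, p, v, b, b', hG, h1, h2, h3⟩ := h
  by_contra hT
  have hI' := irr_strip (x := x) hI
  have hn' := (qlen_strip_le x q).trans hn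
  have hI2 := irr_strip (x := y) hI'
  have hn2 := (qlen_strip_le y _).trans hn'
  have hI3 := irr_strip (x := x) hI2
  have hn3 := (qlen_strip_le x _).trans hn2
  have hx := (strip_spec x (strip y (strip x q))).not_T
  obtain ⟨r, hr⟩ := strip_gate A H P true hG (strip_spec x q) hI hn h3
  obtain ⟨s, hs⟩ := strip_gate A H P false hG (strip_spec y (strip x q)) hI' hn' hr
  obtain ⟨t, ht⟩ := strip_gate A H P true hG (strip_spec x (strip y (strip x q))) hI2 hn2 hs
  rw [ht] at hI3 hn3 hT hx
  have := gate_eq_one A H P hI3 hn3 hG hx hT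
  rw [← mul_assoc (dgen k true ^ r), ← zpow_add, ← mul_assoc, ← mul_assoc, mul_eq_one_iff_inv_eq,
    mul_inv_rev, mul_inv_rev, ← zpow_neg, ← zpow_neg, ← zpow_neg, ← mul_assoc] at this
  have h4 := dih_three_syllables (P.two_le A) (P.four_le A hm) true (-(r + p)) (-s) (-t) b b'
  simp only [Bool.not_true] at h4
  rw [this] at h4
  exact h4 h1 h2

/-- Factorisations with letters of different types come from a dihedral divisor with a gate as
complement. -/
lemma Coh.gate (A : Adm m) {s t : X × Bool} {u u' : Q m} (h : Coh s u t u') (hst : s.1 ≠ t.1)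
    (hI : Irr (qof m s * u)) :
    ∃ k, Pair m s.1 t.1 k ∧ ∃ (g : Dih k) (v : Q m), Gate s.1 t.1 v ∧
      Desc (dgen k) g (true, s.2) ∧ Desc (dgen k) g (false, t.2) ∧
      u = θ m s.1 t.1 k ((letterVal (dgen k) (true, s.2))⁻¹ * g) * v ∧
      u' = θ m s.1 t.1 k ((letterVal (dgen k) (false, t.2))⁻¹ * g) * v := by
  obtain ⟨k, P, g, v, h1, h2, rfl, rfl⟩ := h.ne A hst
  refine ⟨k, P, ?_⟩
  obtain ⟨k', v0, rfl, hG⟩ := exists_gate P _ _ rfl hI.right.right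
  have h3 : wlen (dgen k) (g * k') = wlen (dgen k) g + wlen (dgen k) k' := by
    refine wlen_mul_of_irr P _ _ rfl ?_
    have h4 : qof m s = qof m (lt s.1 t.1 (true, s.2)) := rfl
    rw [h4, ← mul_assoc, ← θ_desc P h1, ← mul_assoc] at hI
    exact hI.left
  have key : ∀ r, Desc (dgen k) g r → Desc (dgen k) (g * k') r ∧
      θ m s.1 t.1 k ((letterVal (dgen k) r)⁻¹ * g) * (θ m s.1 t.1 k k' * v0) =
      θ m s.1 t.1 k ((letterVal (dgen k) r)⁻¹ * (g * k')) * v0 := by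
    intro r hr
    rw [desc_iff (dgg k)] at hr
    have h5 := wlen_mul_le (dgg k) ((letterVal (dgen k) r)⁻¹ * g) k'
    rw [mul_assoc] at h5
    have h6 : Desc (dgen k) (g * k') r := by
      rw [Desc]
      omega
    refine ⟨h6, ?_⟩
    rw [desc_iff (dgg k)] at h6
    rw [← mul_assoc, ← θ_mul P, mul_assoc]
    rw [mul_assoc]
    omega
  exact ⟨g * k', v0, hG, (key _ h1).1, (key _ h2).1, (key _ h1).2, (key _ h2).2⟩

lemma crit_of_T (A : Adm m) (H : HP m n) {q : Q m} (hI : Irr q) (hn : qlen q ≤ n) (hxy : x ≠ y)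
    (hx : T x q) (hy : T y q) : Crit x y q := by
  obtain ⟨b, u, rfl⟩ := hx
  obtain ⟨b', u', h'⟩ := hy
  obtain ⟨k, P, g, v, hG, h1, h2, h3, -⟩ :=
    (H _ _ _ _ hI (by simp at hn; omega) h').gate A hxy hI
  refine ⟨k, P, g, 0, v, b, b', hG, h1, h2, ?_⟩
  rw [zpow_zero, one_mul, θ_desc P h1, mul_assoc, h3]
  rfl

lemma Coh.crit (A : Adm m) {s t : X × Bool} {u u' : Q m} (h : Coh s u t u') (hst : s.1 ≠ t.1)
    (hI : Irr (qof m s * u)) : Crit s.1 t.1 u := by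
  obtain ⟨k, P, g, v, hG, h1, h2, h3, -⟩ := h.gate A hst hI
  refine ⟨k, P, g, if s.2 then -1 else 1, v, s.2, t.2, hG, h1, h2, ?_⟩
  rw [h3]
  obtain ⟨z, b⟩ := s
  cases b <;> simp [letterVal]

end Core

end ThreeFreeArtin

namespace ThreeFreeArtin

variable {X : Type*} {m : X → X → ℕ∞} {n : ℕ}

section Commuting

variable {x y : X} {k : ℕ}

lemma dih_wlen_mul_letter {k : ℕ} (hk : 2 ≤ k) {s t : Bool × Bool} (h : s.1 ≠ t.1) :
    wlen (dgen k) (letterVal (dgen k) s * letterVal (dgen k) t) = 2 := by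
  have h1 := wlen_letterVal (dgg k) t
  rcases wlen_letter_mul (dgg k) s (letterVal (dgen k) t) with h2 | h2
  · omega
  · exfalso
    have h3 : Desc (dgen k) (letterVal (dgen k) t) (letterInv s) := by
      rw [Desc, letterVal_letterInv, inv_inv]
      omega
    obtain ⟨a, b⟩ := s
    obtain ⟨c, d⟩ := t
    obtain rfl : a = !c := by cases a <;> cases c <;> simp_all
    have h4 : letterVal (dgen k) (c, d) = dgen k c ^ (if d then (1 : ℤ) else -1) := by
      cases d <;> simp [letterVal]
    rw [h4] at h3
    exact dih_zpow_not_desc hk c _ _ h3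

lemma qof_comm (P : Pair m x y 2) (b b' : Bool) :
    qof m (x, b) * qof m (y, b') = qof m (y, b') * qof m (x, b) := by
  have h1 := θ_letter_mul P (true, b) (g := letterVal (dgen 2) (false, b'))
    (by rw [dih_wlen_mul_letter le_rfl (by simp), wlen_letterVal (dgg 2)])
  have h2 := θ_letter_mul P (false, b') (g := letterVal (dgen 2) (true, b))
    (by rw [dih_wlen_mul_letter le_rfl (by simp), wlen_letterVal (dgg 2)])
  rw [θ_letterVal P] at h1 h2
  rw [dih_two_comm, h2] at h1
  exact h1.symm

lemma coh_two (P : Pair m x y 2) (b b' : Bool) (h : Q m) :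
    Coh (x, b) (qof m (y, b') * h) (y, b') (qof m (x, b) * h) := by
  have h1 : Desc (dgen 2) (letterVal (dgen 2) (true, b) * letterVal (dgen 2) (false, b'))
      (true, b) := by
    rw [Desc, inv_mul_cancel_left, dih_wlen_mul_letter le_rfl (by simp), wlen_letterVal (dgg 2)]
    omega
  have h2 : Desc (dgen 2) (letterVal (dgen 2) (true, b) * letterVal (dgen 2) (false, b'))
      (false, b') := by
    rw [Desc, dih_two_comm, inv_mul_cancel_left, dih_wlen_mul_letter le_rfl (by simp),
      wlen_letterVal (dgg 2)]
    omega
  have h3 := coh_of P (v := h) h1 h2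
  rw [inv_mul_cancel_left, dih_two_comm, inv_mul_cancel_left, θ_letterVal P, θ_letterVal P] at h3
  exact h3

lemma Coh.two (A : Adm m) {b b' : Bool} {u u' : Q m} (P : Pair m x y 2)
    (h : Coh (x, b) u (y, b') u') : ∃ a, u = qof m (y, b') * a ∧ u' = qof m (x, b) * a := by
  obtain ⟨k, P', g, v, h1, h2, rfl, rfl⟩ := h.ne A P.ne
  obtain rfl := P.eq P'
  have h3 := dih_two_desc (s := (true, b)) (by simp) h2
  have h4 := dih_two_desc (s := (false, b')) (by simp) h1
  refine ⟨θ m x y 2 ((letterVal (dgen 2) (true, b))⁻¹ *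
    ((letterVal (dgen 2) (false, b'))⁻¹ * g)) * v, ?_, ?_⟩
  · dsimp only
    rw [θ_desc P h3, mul_assoc]
    have h5 : (letterVal (dgen 2) (false, b'))⁻¹ * ((letterVal (dgen 2) (true, b))⁻¹ * g) =
        (letterVal (dgen 2) (true, b))⁻¹ * ((letterVal (dgen 2) (false, b'))⁻¹ * g) := by
      rw [← mul_assoc, ← mul_assoc, ← letterVal_letterInv, ← letterVal_letterInv, dih_two_comm]
    rw [h5]
    rfl
  · dsimp only
    rw [θ_desc P h4, mul_assoc]
    rfl

lemma qof_comm_θ {z : X} (Px : Pair m z x 2) (Py : Pair m z y 2) (b : Bool)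
    (g : Dih k) : qof m (z, b) * θ m x y k g = θ m x y k g * qof m (z, b) := by
  unfold θ
  generalize (exists_geodesic (dgg k) g).choose = w
  induction w with
  | nil => simp [qw_nil]
  | cons s w ih =>
    obtain ⟨β, c⟩ := s
    rw [List.map_cons, qw_cons, mul_assoc, ← ih, ← mul_assoc, ← mul_assoc]
    congr 1
    cases β
    exacts [qof_comm Py b c, qof_comm Px b c]

lemma commute_gate (A : Adm m) (H : HP m n) {z : X} (Px : Pair m z x 2) (Py : Pair m z y 2)
    (P : Pair m x y k) (b : Bool) {v : Q m} {h : Dih k} {a : Q m}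
    (he : qof m (z, b) * a = θ m x y k h * v) (hI : Irr (qof m (z, b) * a))
    (hn : qlen (qof m (z, b) * a) ≤ n) :
    ∃ v', v = qof m (z, b) * v' ∧ a = θ m x y k h * v' := by
  generalize hN : wlen (dgen k) h = N
  induction N generalizing h a with
  | zero =>
    rw [wlen_eq_zero (dgg k)] at hN
    subst hN
    rw [θ_one, one_mul] at he
    exact ⟨a, he.symm, by simp⟩
  | succ N ih =>
    have h1 : h ≠ 1 := by
      rintro rfl
      rw [wlen_one] at hN
      omega
    obtain ⟨s, hs⟩ := exists_desc (dgg k) h1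
    have hs' := (desc_iff (dgg k)).1 hs
    rw [θ_desc P hs, mul_assoc] at he
    rw [θ_desc P hs]
    have hc := H _ _ _ _ hI (by simpa [add_comm] using hn) he
    have Pz : Pair m z (lt x y s).1 2 := by
      obtain ⟨β, c⟩ := s
      cases β
      exacts [Py, Px]
    obtain ⟨a', rfl, h3⟩ := hc.two A Pz
    rw [← mul_assoc, qof_comm Pz, mul_assoc] at hI hn
    obtain ⟨v', h4, h5⟩ := ih h3.symm hI.right (by simp at hn ⊢; omega) (by omega)
    exact ⟨v', h4, by rw [h5, mul_assoc]; rfl⟩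

lemma Strip.push (A : Adm m) (H : HP m n) {a b : X} (P : Pair m a b 2) {q q' : Q m}
    (h : Strip b q q') (hI : Irr q) (hn : qlen q ≤ n) {c : Bool} {u : Q m}
    (he : q = qof m (a, c) * u) : ∃ u', Strip b u u' ∧ q' = qof m (a, c) * u' := by
  induction h generalizing u with
  | done q h =>
    refine ⟨u, .done _ ?_, he⟩
    rintro ⟨d, w, rfl⟩
    refine h ⟨d, qof m (a, c) * w, ?_⟩
    rw [he, ← mul_assoc, qof_comm P, mul_assoc]
  | step d q q' h ih =>
    obtain ⟨w, h1, rfl⟩ := (H _ _ _ _ hI (by simp at hn; omega) he).two A (P.symm A)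
    obtain ⟨w', h2, h3⟩ := ih hI.right (by simp at hn; omega) h1
    exact ⟨w', .step _ _ _ h2, h3⟩

lemma Strip.T_of_T {a b : X} (P : Pair m a b 2) {q q' : Q m}
    (h : Strip b q q') (hT : T a q') : T a q := by
  induction h with
  | done q h => exact hT
  | step d q q' h ih =>
    obtain ⟨c, u, rfl⟩ := ih hT
    exact ⟨c, qof m (b, d) * u, by rw [← mul_assoc, ← qof_comm P, mul_assoc]⟩

lemma Strip.comm (A : Adm m) (H : HP m n) {a b : X} (P : Pair m a b 2) {q qa : Q m}
    (h : Strip a q qa) (hI : Irr q) (hn : qlen q ≤ n) {qb z : Q m} (hb : Strip b q qb)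
    (hz : Strip b qa z) : Strip a qb z := by
  induction h generalizing qb with
  | done q h =>
    obtain rfl := hb.unique A H hI hn hz
    exact .done _ fun hT => h (hb.T_of_T P hT)
  | step c u qa h ih =>
    obtain ⟨ub, h1, rfl⟩ := hb.push A H P hI hn rfl
    exact .step _ _ _ (ih hI.right (by simp at hn; omega) h1 hz)

lemma strip_comm (A : Adm m) (H : HP m n) {a b : X} (P : Pair m a b 2) {q : Q m}
    (hI : Irr q) (hn : qlen q ≤ n) : strip a (strip b q) = strip b (strip a q) :=
  ((strip_spec a q).comm A H P hI hn (strip_spec b q) (strip_spec b _)).eq_strip A H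
    (irr_strip hI) ((qlen_strip_le _ _).trans hn)

end Commuting

section Triples

variable {a b c : X}

lemma no_triple_two (A : Adm m) (H : HP m n) (P : Pair m a b 2) (hac : a ≠ c) (hbc : b ≠ c)
    (mac : m a c ≠ 2) (mbc : m b c ≠ 2) : ∀ (N : ℕ) (q : Q m), qlen q = N → Irr q → N ≤ n →
      T a q → T b q → T c (strip a q) → T c (strip b q) → False := by
  intro N
  induction N using Nat.strong_induction_on with
  | _ N ih =>
    intro q hN hI hn hTa hTb h1 h2
    rw [← hN] at hn
    have key : ∀ {a b : X} (_ : Pair m a b 2) (_ : b ≠ c) (_ : m b c ≠ 2) (_ : T a q) (_ : T b q)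
        (_ : T c (strip a q)), T c (strip b (strip a q)) ∧
          T b (strip c (strip b (strip a q))) ∧ T c (strip b (strip c (strip b (strip a q)))) := by
      intro a b P hbc mbc hTa hTb h1
      have h3 := (crit_of_T A H hI hn P.ne hTa hTb).T_strip A H hI hn
      have hI' := irr_strip (x := a) hI
      have hn' := (qlen_strip_le a q).trans hn
      have h4 := crit_of_T A H hI' hn' hbc h3 h1
      exact ⟨h4.T_strip A H hI' hn', h4.T_strip_strip A H hI' hn' mbc,
        h4.T_strip_strip_strip A H hI' hn' mbc⟩
    obtain ⟨h3, h4, h5⟩ := key P hbc mbc hTa hTb h1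
    obtain ⟨h6, h7, h8⟩ := key (P.symm A) hac mac hTb hTa h2
    rw [strip_comm A H P hI hn] at h6 h7 h8
    have hI' := irr_strip (x := b) (irr_strip (x := a) hI)
    have hl : qlen (strip c (strip b (strip a q))) < qlen q :=
      ((strip_spec c _).qlen_lt h3).trans_le ((qlen_strip_le _ _).trans (qlen_strip_le _ _))
    exact ih _ (by omega) _ rfl (irr_strip hI') (by omega) h7 h4 h8 h5

lemma no_triple (A : Adm m) (H : HP m n) : ∀ (N : ℕ) (q : Q m) (a b c : X), a ≠ b → b ≠ c →
    a ≠ c → m a b ≠ 2 → m b c ≠ 2 → m a c ≠ 2 → qlen q = N → Irr q → N ≤ n →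
      T a q → T b q → T c (strip a q) → False := by
  intro N
  induction N using Nat.strong_induction_on with
  | _ N ih =>
    intro q a b c hab hbc hac mab mbc mac hN hI hn hTa hTb h1
    rw [← hN] at hn
    have h2 := crit_of_T A H hI hn hab hTa hTb
    have hl := (strip_spec a q).qlen_lt hTa
    exact ih _ (by omega) (strip a q) b c a hbc hac.symm hab.symm mbc (by rwa [A.symm])
      (by rwa [A.symm]) rfl (irr_strip hI) (by omega) (h2.T_strip A H hI hn) h1
      (h2.T_strip_strip A H hI hn mab)

end Triples

section Transitivity

variable {x y z : X} {b c d : Bool} {u v w : Q m}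

lemma Coh.trans_same (A : Adm m) (H : HP m n) (h1 : Coh (x, b) u (y, c) v)
    (h2 : Coh (y, c) v (x, d) w) (hxy : x ≠ y) (hI : Irr (qof m (y, c) * v)) (hn : qlen v ≤ n) :
    Coh (x, b) u (x, d) w := by
  obtain ⟨k, P, g, v1, hG, h3, h4, rfl, rfl⟩ := h1.symm.gate A hxy.symm hI
  obtain ⟨k', P', g', v2, hG', h5, h6, h7, rfl⟩ := h2.gate A hxy.symm hI
  obtain rfl := P.eq P'
  dsimp only at *
  obtain ⟨e, h8, h9, rfl⟩ := gate_div A H P _ _ _ _ _ hn rfl hI.right hG h7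
  rw [mul_assoc] at h8
  obtain rfl := mul_left_cancel h8
  have h10 := (desc_iff (dgg k)).1 h3
  have h11 := (desc_iff (dgg k)).1 h5
  have h12 := (desc_iff (dgg k)).1 h6
  have h13 := wlen_mul_le (dgg k) ((letterVal (dgen k) (false, d))⁻¹ * g') e
  rw [mul_assoc] at h13
  have h14 : Desc (dgen k) (g' * e) (false, d) := by
    rw [Desc]
    omega
  have h15 : b = d := by
    rcases eq_or_eq_letterInv (s := ((false, b) : Bool × Bool)) (t := (false, d)) rfl with h | h
    · simpa using h
    · rw [h] at h4
      exact absurd h4 (dih_not_desc_both (P.two_le A) _ _ h14)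
  subst h15
  rw [desc_iff (dgg k)] at h14
  rw [← mul_assoc (θ _ _ _ _ _), ← θ_mul P, mul_assoc]
  · exact Coh.refl _ _
  · rw [mul_assoc]
    omega

lemma Coh.trans_two_two (A : Adm m) (H : HP m n) (h1 : Coh (x, b) u (y, c) v)
    (h2 : Coh (y, c) v (z, d) w) (P : Pair m x y 2) (P' : Pair m y z 2) (hxz : x ≠ z)
    (hI : Irr v) (hn : qlen v ≤ n) : Coh (x, b) u (z, d) w := by
  obtain ⟨a, rfl, rfl⟩ := h1.two A P
  obtain ⟨a', h3, rfl⟩ := h2.two A P'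
  obtain ⟨k, P'', g, v, h4, h5, rfl, rfl⟩ :=
    (H _ _ _ _ hI (by simp at hn; omega) h3).ne A hxz
  rw [← mul_assoc, ← mul_assoc, qof_comm_θ (P.symm A) P', qof_comm_θ (P.symm A) P',
    mul_assoc, mul_assoc]
  exact coh_of P'' h4 h5

lemma Coh.trans_two_four (A : Adm m) (H : HP m n) (h1 : Coh (x, b) u (y, c) v)
    (h2 : Coh (y, c) v (z, d) w) (P : Pair m x y 2) (hyz : y ≠ z) (m' : m y z ≠ 2) (hxz : x ≠ z)
    (hI : Irr (qof m (y, c) * v)) (hn : qlen v ≤ n) : Coh (x, b) u (z, d) w := by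
  by_cases mxz : m x z = 2
  · have P' : Pair m x z 2 := ⟨hxz, mxz⟩
    obtain ⟨a, rfl, rfl⟩ := h1.two A P
    obtain ⟨k, P'', g, v, h4, h5, h6, rfl⟩ := h2.ne A hyz
    obtain ⟨v', rfl, rfl⟩ := commute_gate A H P P' P'' b h6 hI.right hn
    dsimp only at *
    have h7 : qof m (y, c) * (θ m y z k ((letterVal (dgen k) (true, c))⁻¹ * g) * v') =
        qof m (z, d) * (θ m y z k ((letterVal (dgen k) (false, d))⁻¹ * g) * v') := by
      rw [← mul_assoc, ← mul_assoc]
      congr 1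
      exact (θ_desc P'' h4).symm.trans (θ_desc P'' h5)
    rw [h7, ← mul_assoc (θ _ _ _ _ _) (qof m (x, b)), ← qof_comm_θ P P', mul_assoc]
    exact coh_two P' b d _
  · exfalso
    have hI' := hI.right
    have hTx : T x v := by
      obtain ⟨a, -, rfl⟩ := h1.two A P
      exact ⟨b, a, rfl⟩
    have hc1 := h1.symm.crit A P.ne.symm hI
    have hc2 := h2.crit A hyz hI
    dsimp only at hc1 hc2
    have hI2 := irr_strip (x := y) hI'
    have hn2 := (qlen_strip_le y v).trans hn
    have hTx2 := hc1.T_strip A H hI' hn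
    have hTz2 := hc2.T_strip A H hI' hn
    have hc3 := crit_of_T A H hI2 hn2 hxz hTx2 hTz2
    have hc4 := crit_of_T A H hI2 hn2 hxz.symm hTz2 hTx2
    have hI3 := irr_strip (x := z) hI2
    have hn3 := (qlen_strip_le z _).trans hn2
    exact no_triple_two A H P hxz hyz mxz m' _ _ rfl hI3 hn3 (hc4.T_strip A H hI2 hn2)
      (hc2.T_strip_strip A H hI' hn m') (hc4.T_strip_strip A H hI2 hn2 (by rwa [A.symm]))
      (hc2.T_strip_strip_strip A H hI' hn m')

lemma Coh.not_four_four (A : Adm m) (H : HP m n) (h1 : Coh (x, b) u (y, c) v)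
    (h2 : Coh (y, c) v (z, d) w) (hxy : x ≠ y) (hyz : y ≠ z) (mxy : m x y ≠ 2) (myz : m y z ≠ 2)
    (hxz : x ≠ z) (hI : Irr (qof m (y, c) * v)) (hn : qlen v ≤ n) : False := by
  have hI' := hI.right
  have myx : m y x ≠ 2 := by rwa [A.symm]
  have mzy : m z y ≠ 2 := by rwa [A.symm]
  have hc1 := h1.symm.crit A hxy.symm hI
  have hc2 := h2.crit A hyz hI
  dsimp only at hc1 hc2
  have hI2 := irr_strip (x := y) hI'
  have hn2 := (qlen_strip_le y v).trans hn
  have hTx := hc1.T_strip A H hI' hn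
  have hTz := hc2.T_strip A H hI' hn
  have hTy := hc1.T_strip_strip A H hI' hn myx
  have hTy' := hc2.T_strip_strip A H hI' hn myz
  by_cases mxz : m x z = 2
  · exact no_triple_two A H ⟨hxz, mxz⟩ hxy hyz.symm mxy mzy _ _ rfl hI2 hn2 hTx hTz hTy hTy'
  · exact no_triple A H _ _ x z y hxz hyz.symm hxy mxz mzy mxy rfl hI2 hn2 hTx hTz hTy

end Transitivity

lemma Coh.trans (A : Adm m) (H : HP m n) {s0 s1 s2 : X × Bool} {u0 u1 u2 : Q m}
    (h1 : Coh s0 u0 s1 u1) (h2 : Coh s1 u1 s2 u2) (hI : Irr (qof m s1 * u1))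
    (hn : qlen u1 ≤ n) : Coh s0 u0 s2 u2 := by
  by_cases h01 : s0.1 = s1.1
  · obtain ⟨rfl, rfl⟩ := h1.same A h01
    exact h2
  by_cases h12 : s1.1 = s2.1
  · obtain ⟨rfl, rfl⟩ := h2.same A h12
    exact h1
  obtain ⟨x, b⟩ := s0
  obtain ⟨y, c⟩ := s1
  obtain ⟨z, d⟩ := s2
  dsimp only at h01 h12
  by_cases h02 : x = z
  · subst h02
    exact h1.trans_same A H h2 h01 hI hn
  by_cases m01 : m x y = 2 <;> by_cases m12 : m y z = 2
  · exact h1.trans_two_two A H h2 ⟨h01, m01⟩ ⟨h12, m12⟩ h02 hI.right hn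
  · exact h1.trans_two_four A H h2 ⟨h01, m01⟩ h12 m12 h02 hI hn
  · exact (h2.symm.trans_two_four A H h1.symm ⟨Ne.symm h12, by rw [A.symm]; exact m12⟩
      (Ne.symm h01) (by rwa [A.symm]) (Ne.symm h02) hI hn).symm
  · exact (h1.not_four_four A H h2 h01 h12 m01 m12 h02 hI hn).elim

lemma hp_succ (A : Adm m) (H : HP m n) : HP m (n + 1) := by
  intro s u t u' hI hn he
  have key : ∀ a b : (X × Bool) × Q m, Relation.EqvGen Step a b →
      qof m a.1 * a.2 = qof m b.1 * b.2 ∧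
      (Irr (qof m a.1 * a.2) → qlen a.2 ≤ n → Coh a.1 a.2 b.1 b.2) := by
    intro a b h
    induction h with
    | rel a b h => exact ⟨h.eq, fun _ _ => Or.inr h⟩
    | refl a => exact ⟨rfl, fun _ _ => Coh.refl _ _⟩
    | symm a b _ ih =>
      refine ⟨ih.1.symm, fun h1 h2 => ?_⟩
      have h3 := congrArg qlen ih.1
      rw [← ih.1] at h1
      rw [qlen_mul, qlen_mul, qlen_qof, qlen_qof] at h3
      exact (ih.2 h1 (by omega)).symm
    | trans a b c _ _ ih1 ih2 =>
      refine ⟨ih1.1.trans ih2.1, fun h1 h2 => ?_⟩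
      have h3 := congrArg qlen ih1.1
      have h4 := h1
      rw [ih1.1] at h4
      rw [qlen_mul, qlen_mul, qlen_qof, qlen_qof] at h3
      exact (ih1.2 h1 h2).trans A H (ih2.2 h4 (by omega)) h4 (by omega)
  exact (key _ _ (chain he)).2 hI (by dsimp only; omega)

lemma hp (A : Adm m) (n : ℕ) : HP m n := by
  induction n with
  | zero => exact fun s u t u' _ h => absurd h (by omega)
  | succ n ih => exact hp_succ A ih

end ThreeFreeArtin

namespace ThreeFreeArtin

variable {X : Type*} {m : X → X → ℕ∞}

lemma Irr.not_cons {s : X × Bool} {q : Q m} (h : Irr (qof m s * q)) (u : Q m) :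
    q ≠ qof m (letterInv s) * u := by
  rintro rfl
  exact h 1 s u (by rw [one_mul, mul_assoc])

lemma irr_one : Irr (1 : Q m) := by
  intro p s r h
  have := congrArg qlen h
  simp at this
  omega

lemma irr_cons (A : Adm m) {s : X × Bool} {q : Q m} (h : Irr q)
    (hs : ∀ u, q ≠ qof m (letterInv s) * u) : Irr (qof m s * q) :=
  (irrGate_and_irrCons A (hp A (qlen q))).2 s q h le_rfl hs

lemma irr_gate (A : Adm m) {x y : X} {k : ℕ} (P : Pair m x y k) (g : Dih k) {v : Q m}
    (h : Irr v) (hG : Gate x y v) : Irr (θ m x y k g * v) :=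
  (irrGate_and_irrCons A (hp A _)).1 x y k P g v h hG le_rfl

lemma qof_mul_left_cancel (A : Adm m) {s : X × Bool} {u u' : Q m} (h : Irr (qof m s * u))
    (he : qof m s * u = qof m s * u') : u = u' :=
  ((hp A _ s u s u' h le_rfl he).same A rfl).2

section Action

open Classical in
/-- The action of letters on irreducible elements. -/
noncomputable def act (s : X × Bool) (q : Q m) : Q m :=
  if h : ∃ u, q = qof m (letterInv s) * u then h.choose else qof m s * q

lemma act_inv_mul (A : Adm m) {s : X × Bool} {u : Q m} (h : Irr (qof m (letterInv s) * u)) :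
    act s (qof m (letterInv s) * u) = u := by
  have h' : ∃ u', qof m (letterInv s) * u = qof m (letterInv s) * u' := ⟨u, rfl⟩
  rw [act, dif_pos h']
  exact (qof_mul_left_cancel A h h'.choose_spec).symm

lemma act_of_ne {s : X × Bool} {q : Q m} (h : ∀ u, q ≠ qof m (letterInv s) * u) :
    act s q = qof m s * q :=
  dif_neg fun ⟨u, hu⟩ => h u hu

lemma irr_act (A : Adm m) (s : X × Bool) {q : Q m} (h : Irr q) : Irr (act s q) := by
  by_cases hs : ∃ u, q = qof m (letterInv s) * u
  · obtain ⟨u, rfl⟩ := hs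
    rw [act_inv_mul A h]
    exact h.right
  · have hs' : ∀ u, q ≠ qof m (letterInv s) * u := fun u hu => hs ⟨u, hu⟩
    rw [act_of_ne hs']
    exact irr_cons A h hs'

lemma act_letterInv_act (A : Adm m) (s : X × Bool) {q : Q m} (h : Irr q) :
    act (letterInv s) (act s q) = q := by
  by_cases hs : ∃ u, q = qof m (letterInv s) * u
  · obtain ⟨u, rfl⟩ := hs
    rw [act_inv_mul A h, act_of_ne h.not_cons]
  · have hs' : ∀ u, q ≠ qof m (letterInv s) * u := fun u hu => hs ⟨u, hu⟩
    have h1 := irr_cons A h hs'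
    rw [act_of_ne hs']
    have h2 := act_inv_mul A (s := letterInv s) (u := q)
    rw [letterInv_letterInv] at h2
    exact h2 h1

lemma act_gate (A : Adm m) {x y : X} {k : ℕ} (P : Pair m x y k) (s : Bool × Bool) (g : Dih k)
    {v : Q m} (h : Irr v) (hG : Gate x y v) :
    act (lt x y s) (θ m x y k g * v) = θ m x y k (letterVal (dgen k) s * g) * v := by
  have hI := irr_gate A P g h hG
  by_cases hs : Desc (dgen k) g (letterInv s)
  · rw [θ_desc P hs, mul_assoc] at hI ⊢
    rw [lt_letterInv] at hI ⊢
    rw [act_inv_mul A hI, letterVal_letterInv, inv_inv]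
  · have hs' := (not_desc_letterInv_iff (dgg k)).1 hs
    rw [θ_letter_mul P s hs', mul_assoc]
    exact act_of_ne fun u hu => hs (gate_letter A (hp A _) P (s := letterInv s) le_rfl hI hG hu).1

/-- The permutation of the irreducible elements given by a generator. -/
noncomputable def genPerm (A : Adm m) (x : X) : Equiv.Perm {q : Q m // Irr q} where
  toFun q := ⟨act (x, true) q.1, irr_act A _ q.2⟩
  invFun q := ⟨act (x, false) q.1, irr_act A _ q.2⟩
  left_inv q := Subtype.ext (act_letterInv_act A (x, true) q.2)
  right_inv q := Subtype.ext (act_letterInv_act A (x, false) q.2)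

lemma altMul_genPerm (A : Adm m) {x y : X} {k : ℕ} (P : Pair m x y k) {v : Q m} (h : Irr v)
    (hG : Gate x y v) (g : Dih k) (j : ℕ) (β : Bool) :
    altMul j (genPerm A (pr x y β)) (genPerm A (pr x y !β))
      ⟨θ m x y k g * v, irr_gate A P g h hG⟩ =
    ⟨θ m x y k (altMul j (dgen k β) (dgen k !β) * g) * v, irr_gate A P _ h hG⟩ := by
  induction j generalizing β with
  | zero => simp [altMul]
  | succ j ih =>
    have := ih !β
    rw [Bool.not_not] at this
    rw [altMul, Equiv.Perm.mul_apply, this]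
    apply Subtype.ext
    refine (act_gate A P (β, true) _ h hG).trans ?_
    simp [altMul, letterVal, mul_assoc]

/-- The action of the Artin group on the irreducible elements. -/
noncomputable def artinAct (A : Adm m) : ArtinGroup m →* Equiv.Perm {q : Q m // Irr q} :=
  artinLift (genPerm A) (by
    intro x y hxy k hk
    have P : Pair m x y k := ⟨hxy, hk⟩
    ext1 ⟨q, hq⟩
    obtain ⟨g, v, rfl, hG⟩ := exists_gate P _ q rfl hq
    have h1 := altMul_genPerm A P hq.right hG g k true
    have h2 := altMul_genPerm A P hq.right hG g k false
    have h3 : altMul k (dgen k true) (dgen k false) = altMul k (dgen k false) (dgen k true) :=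
      altMul_artinGen (by simp) rfl
    simp only [Bool.not_true, Bool.not_false] at h1 h2
    refine h1.trans (Eq.trans ?_ h2.symm)
    simp only [h3])

lemma artinAct_letterVal (A : Adm m) (s : X × Bool) (q : {q : Q m // Irr q}) :
    (artinAct A (letterVal (artinGen m) s) q).1 = act s q.1 := by
  obtain ⟨x, b⟩ := s
  cases b
  · simp only [letterVal, artinAct]
    rfl
  · simp only [letterVal, artinAct]
    rfl

end Action

section Eval

/-- The homomorphism from a dihedral Artin group given by two generators. -/
noncomputable def dihMap (A : Adm m) {x y : X} {k : ℕ} (P : Pair m x y k) :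
    Dih k →* ArtinGroup m :=
  artinLift (fun β => artinGen m (pr x y β)) (by
    intro a b hab l hl
    obtain rfl : k = l := by exact_mod_cast hl
    cases a <;> cases b
    · rfl
    · exact altMul_artinGen P.ne.symm (P.symm A).lab
    · exact altMul_artinGen P.ne P.lab
    · rfl)

lemma dihMap_letterVal (A : Adm m) {x y : X} {k : ℕ} (P : Pair m x y k) (s : Bool × Bool) :
    dihMap A P (letterVal (dgen k) s) = letterVal (artinGen m) (lt x y s) := by
  obtain ⟨β, b⟩ := s
  have h : dihMap A P (dgen k β) = artinGen m (pr x y β) := artinLift_gen _ _ β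
  cases b <;> simp [letterVal, lt, h]

lemma dihMap_evalWord (A : Adm m) {x y : X} {k : ℕ} (P : Pair m x y k) (d : Word Bool) :
    dihMap A P (evalWord (dgen k) d) = evalWord (artinGen m) (d.map (lt x y)) := by
  induction d with
  | nil => simp [evalWord_nil]
  | cons s d ih => simp [evalWord_cons, ih, dihMap_letterVal]

/-- Evaluation of classes of words in the Artin group. -/
noncomputable def ev (A : Adm m) : Q m →* ArtinGroup m :=
  qlift (letterVal (artinGen m)) (by
    intro x y k d d' P _ _ h
    have key : ∀ d : Word Bool, (d.map fun s => letterVal (artinGen m) (lt x y s)).prod =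
        dihMap A P (evalWord (dgen k) d) := by
      intro d
      rw [dihMap_evalWord]
      induction d with
      | nil => rfl
      | cons s d ih => rw [List.map_cons, List.prod_cons, ih]; rfl
    rw [key, key, h])

lemma ev_qof (A : Adm m) (s : X × Bool) : ev A (qof m s) = letterVal (artinGen m) s :=
  qlift_qof _ _ s

lemma ev_qw (A : Adm m) (w : Word X) : ev A (qw m w) = evalWord (artinGen m) w := by
  induction w with
  | nil => exact map_one _
  | cons s w ih => rw [qw_cons, map_mul, ev_qof, ih, evalWord_cons]

lemma ev_θ (A : Adm m) {x y : X} {k : ℕ} (P : Pair m x y k) (g : Dih k) :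
    ev A (θ m x y k g) = dihMap A P g := by
  rw [θ, ev_qw, ← dihMap_evalWord A P, (exists_geodesic (dgg k) g).choose_spec.1]

lemma artinAct_ev (A : Adm m) {q : Q m} (h : Irr q) :
    artinAct A (ev A q) ⟨1, irr_one⟩ = ⟨q, h⟩ := by
  obtain ⟨w, rfl⟩ := exists_qw q
  induction w with
  | nil => simp [qw_nil]
  | cons s w ih =>
    have h' : Irr (qof m s * qw m w) := h
    apply Subtype.ext
    change (artinAct A (ev A (qof m s * qw m w)) ⟨1, irr_one⟩).1 = qof m s * qw m w
    rw [map_mul, map_mul, Equiv.Perm.mul_apply, ih h'.right, ev_qof, artinAct_letterVal]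
    exact act_of_ne h'.not_cons

lemma ev_inj (A : Adm m) {q q' : Q m} (h : Irr q) (h' : Irr q') (he : ev A q = ev A q') :
    q = q' := by
  have h1 := artinAct_ev A h
  rw [he, artinAct_ev A h'] at h1
  exact (congrArg Subtype.val h1).symm

lemma wlen_ev_le (A : Adm m) (q : Q m) : wlen (artinGen m) (ev A q) ≤ qlen q := by
  obtain ⟨w, rfl⟩ := exists_qw q
  rw [ev_qw, qlen_qw]
  exact wlen_evalWord_le _ _

lemma irr_of_qlen (A : Adm m) {q : Q m} (h : qlen q = wlen (artinGen m) (ev A q)) : Irr q := by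
  rintro p s r rfl
  have h1 : ev A (p * qof m s * qof m (letterInv s) * r) = ev A (p * r) := by
    simp [ev_qof]
  have h2 := wlen_ev_le A (p * r)
  rw [h1] at h
  simp at h h2
  omega

lemma exists_ev (A : Adm m) (g : ArtinGroup m) :
    ∃ q, ev A q = g ∧ Irr q ∧ qlen q = wlen (artinGen m) g := by
  obtain ⟨w, rfl, hw⟩ := exists_geodesic (gradedGen_artinGen m) g
  refine ⟨qw m w, ev_qw A w, irr_of_qlen A ?_, ?_⟩
  · rw [ev_qw, qlen_qw, hw]
  · rw [qlen_qw, hw]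

lemma wlen_ev (A : Adm m) {q : Q m} (h : Irr q) : wlen (artinGen m) (ev A q) = qlen q := by
  obtain ⟨q', h1, h2, h3⟩ := exists_ev A (ev A q)
  rw [← h3, ev_inj A h h2 h1.symm]

lemma exists_of_desc_ev (A : Adm m) {q : Q m} (h : Irr q) {s : X × Bool}
    (hs : Desc (artinGen m) (ev A q) s) : ∃ u, q = qof m s * u := by
  rw [desc_iff (gradedGen_artinGen m)] at hs
  obtain ⟨u, h1, -, h3⟩ := exists_ev A ((letterVal (artinGen m) s)⁻¹ * ev A q)
  have h4 : ev A (qof m s * u) = ev A q := by rw [map_mul, ev_qof, h1, mul_inv_cancel_left]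
  refine ⟨u, ev_inj A h (irr_of_qlen A ?_) h4.symm⟩
  rw [h4, qlen_mul, qlen_qof]
  omega

end Eval

section Group

lemma artin_not_desc_both (A : Adm m) {g : ArtinGroup m} {s : X × Bool}
    (h : Desc (artinGen m) g s) : ¬ Desc (artinGen m) g (letterInv s) := by
  intro h'
  obtain ⟨q, rfl, hI, -⟩ := exists_ev A g
  obtain ⟨u, rfl⟩ := exists_of_desc_ev A hI h
  obtain ⟨u', h2⟩ := exists_of_desc_ev A hI h'
  exact letterInv_ne s ((hp A _ _ _ _ _ hI le_rfl h2).same A rfl).1.symm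

lemma artin_gate (A : Adm m) {x y : X} {k : ℕ} (P : Pair m x y k) (g : ArtinGroup m) :
    ∃ (e : Dih k) (v : ArtinGroup m), g = dihMap A P e * v ∧
      ∀ d, wlen (artinGen m) (dihMap A P d * v) = wlen (dgen k) d + wlen (artinGen m) v := by
  obtain ⟨q, rfl, hI, -⟩ := exists_ev A g
  obtain ⟨e, v, rfl, hG⟩ := exists_gate P _ q rfl hI
  refine ⟨e, ev A v, by rw [map_mul, ev_θ A P], fun d => ?_⟩
  rw [← ev_θ A P, ← map_mul, wlen_ev A (irr_gate A P d hI.right hG), wlen_ev A hI.right,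
    qlen_mul, qlen_θ]

lemma artin_two_desc (A : Adm m) {g : ArtinGroup m} {s t : X × Bool} (hst : s.1 ≠ t.1)
    (hs : Desc (artinGen m) g s) (ht : Desc (artinGen m) g t) :
    ∃ (k : ℕ) (P : Pair m s.1 t.1 k) (c : Dih k) (v : ArtinGroup m), g = dihMap A P c * v ∧
      Desc (dgen k) c (true, s.2) ∧ Desc (dgen k) c (false, t.2) ∧
      ∀ d, wlen (artinGen m) (dihMap A P d * v) = wlen (dgen k) d + wlen (artinGen m) v := by
  obtain ⟨q, rfl, hI, -⟩ := exists_ev A g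
  obtain ⟨u, rfl⟩ := exists_of_desc_ev A hI hs
  obtain ⟨u', h'⟩ := exists_of_desc_ev A hI ht
  obtain ⟨k, P, c, v, hG, h1, h2, rfl, -⟩ := (hp A _ _ _ _ _ hI le_rfl h').gate A hst hI
  refine ⟨k, P, c, ev A v, ?_, h1, h2, fun d => ?_⟩
  · have h3 : qof m s = qof m (lt s.1 t.1 (true, s.2)) := rfl
    rw [h3, ← mul_assoc, ← θ_desc P h1, map_mul, ev_θ A P]
  · rw [← ev_θ A P, ← map_mul, wlen_ev A (irr_gate A P d hI.right.right hG),
      wlen_ev A hI.right.right, qlen_mul, qlen_θ]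

lemma letterVal_mul_ne_one (a b : X) (ε : Bool) :
    letterVal (artinGen m) (a, ε) * letterVal (artinGen m) (b, ε) ≠ 1 := by
  obtain ⟨σ, h⟩ := (gradedGen_artinGen m).deg
  intro he
  have := congrArg (fun g => (σ g).toAdd) he
  cases ε <;> simp [letterVal, h] at this

/-- Left and right multiplication by letters of the same sign, each increasing the length, together
increase the length by two. -/
lemma artin_extend (A : Adm m) : ∀ (N : ℕ) (g : ArtinGroup m) (a b : X) (ε : Bool), wlen (artinGen m) g = N →
    wlen (artinGen m) (letterVal (artinGen m) (a, ε) * g) = N + 1 →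
    wlen (artinGen m) (g * letterVal (artinGen m) (b, ε)) = N + 1 →
    wlen (artinGen m) (letterVal (artinGen m) (a, ε) * g * letterVal (artinGen m) (b, ε)) = N + 2 := by
  intro N
  induction N using Nat.strong_induction_on with
  | _ N ih =>
    intro g a b ε hg hag hgb
    have hf := gradedGen_artinGen m
    by_contra hne
    have hagb : wlen (artinGen m) (letterVal (artinGen m) (a, ε) * g * letterVal (artinGen m) (b, ε)) = N := by
      have := wlen_mul_letter hf (b, ε) (letterVal (artinGen m) (a, ε) * g)
      omega
    have hg1 : g ≠ 1 := by
      rintro rfl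
      rw [wlen_one] at hg
      rw [mul_one, ← hg, wlen_eq_zero hf] at hagb
      exact letterVal_mul_ne_one a b ε hagb
    obtain ⟨t, ht⟩ := exists_desc hf hg1
    have ht' := (desc_iff hf).1 ht
    have hka : Desc (artinGen m) (g * letterVal (artinGen m) (b, ε)) (letterInv (a, ε)) := by
      rw [Desc, letterVal_letterInv, inv_inv, ← mul_assoc]
      omega
    have hkt : Desc (artinGen m) (g * letterVal (artinGen m) (b, ε)) t := by
      rw [Desc, ← mul_assoc]
      have := wlen_mul_letter hf (b, ε) ((letterVal (artinGen m) t)⁻¹ * g)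
      omega
    have hat : (letterInv (a, ε)).1 ≠ t.1 := by
      intro h
      rcases eq_or_eq_letterInv h with h | h
      · rw [← h, Desc, letterVal_letterInv, inv_inv] at ht
        omega
      · rw [h] at hka
        exact artin_not_desc_both A hkt hka
    obtain ⟨k, P, c, v, hk, hc1, hc2, hv⟩ := artin_two_desc A hat hka hkt
    have hD := dgg k
    obtain ⟨e, v', he, hv'⟩ := artin_gate A P (v * (letterVal (artinGen m) (b, ε))⁻¹)
    have hg2 : g = dihMap A P (c * e) * v' := by
      rw [map_mul, mul_assoc, ← he, ← mul_assoc, ← hk, mul_inv_cancel_right]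
    have l1 : wlen (artinGen m) (g * letterVal (artinGen m) (b, ε)) = wlen (dgen k) c + wlen (artinGen m) v := by rw [hk, hv]
    have l2 : wlen (artinGen m) g = wlen (dgen k) (c * e) + wlen (artinGen m) v' := by rw [hg2, hv']
    have l3 : wlen (artinGen m) (letterVal (artinGen m) (a, ε) * g) =
        wlen (dgen k) (letterVal (dgen k) (true, ε) * (c * e)) + wlen (artinGen m) v' := by
      rw [← hv', map_mul, dihMap_letterVal, mul_assoc, ← hg2]
      rfl
    have l4 : wlen (artinGen m) ((letterVal (artinGen m) t)⁻¹ * g) =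
        wlen (dgen k) ((letterVal (dgen k) (false, t.2))⁻¹ * (c * e)) + wlen (artinGen m) v' := by
      rw [← hv', map_mul, map_inv, dihMap_letterVal, mul_assoc, ← hg2]
      rfl
    have l5 : wlen (artinGen m) (v * (letterVal (artinGen m) (b, ε))⁻¹) = wlen (dgen k) e + wlen (artinGen m) v' := by rw [he, hv']
    have l6 : wlen (artinGen m) (v' * letterVal (artinGen m) (b, ε)) = wlen (dgen k) e + wlen (artinGen m) v := by
      have h1 : v' * letterVal (artinGen m) (b, ε) = dihMap A P e⁻¹ * v := by
        rw [map_inv, eq_inv_mul_iff_mul_eq, ← mul_assoc, ← he, inv_mul_cancel_right]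
      rw [h1, hv, wlen_inv hD]
    have l7 := wlen_mul_letter hf (letterInv (b, ε)) v
    rw [letterVal_letterInv] at l7
    have l8 := wlen_mul_letter hf (b, ε) v'
    have l9 := (desc_iff hD).1 hc1
    have h9 : (letterVal (dgen k) (true, (letterInv (a, ε)).2))⁻¹ =
        letterVal (dgen k) (true, ε) := by
      rw [← letterVal_letterInv]
      simp [letterInv]
    rw [h9] at l9
    by_cases he1 : e = 1
    · subst he1
      rw [mul_one] at l2 l3
      omega
    obtain ⟨⟨β, δ⟩, hd⟩ := exists_desc hD he1
    have he0 : wlen (dgen k) e ≠ 0 := by rwa [Ne, wlen_eq_zero hD]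
    have hd0 := (desc_iff hD).1 hd
    have hd1 : wlen (dgen k) ((letterVal (dgen k) (β, δ))⁻¹ * e) = 0 := by omega
    rw [wlen_eq_zero hD, inv_mul_eq_one] at hd1
    subst hd1
    have hd2 := wlen_letterVal hD (β, δ)
    by_cases hδ : δ = ε
    · subst hδ
      have h1 := ih (wlen (artinGen m) v) (by omega) v (pr (letterInv (a, δ)).1 t.1 β) b (!δ) rfl
      have h2 : letterVal (artinGen m) (pr (letterInv (a, δ)).1 t.1 β, !δ) =
          dihMap A P (letterVal (dgen k) (β, δ))⁻¹ := by
        rw [← letterVal_letterInv, dihMap_letterVal]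
        rfl
      have h3 : letterVal (artinGen m) (b, !δ) = (letterVal (artinGen m) (b, δ))⁻¹ :=
        letterVal_letterInv _ (b, δ)
      rw [h2, h3, hv, wlen_inv hD, mul_assoc, he, map_inv, inv_mul_cancel_left, ← he] at h1
      have := h1 (by omega) (by omega)
      omega
    · obtain rfl : δ = !ε := by cases δ <;> cases ε <;> simp_all
      have h1 := dih_extend (P.two_le A) (c * letterVal (dgen k) (β, !ε)) true β ε (by omega)
      have h2 : letterVal (dgen k) (β, !ε) = (letterVal (dgen k) (β, ε))⁻¹ :=
        letterVal_letterInv _ (β, ε)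
      have h3 : c * letterVal (dgen k) (β, !ε) * letterVal (dgen k) (β, ε) = c := by
        rw [h2, mul_assoc, inv_mul_cancel, mul_one]
      rw [mul_assoc (letterVal (dgen k) (true, ε)), h3] at h1
      have h4 : wlen (dgen k) c = wlen (dgen k) (c * letterVal (dgen k) (β, !ε)) + 1 := by omega
      have h5 := h1 h4
      clear * - h4 h5 l9
      omega

lemma isGeodesic_left {G : Type*} [Group G] {f : X → G} {v w : Word X}
    (h : IsGeodesic f (v ++ w)) : IsGeodesic f v := by
  intro v' hv'
  have := h (v' ++ w) (by rw [evalWord_append, evalWord_append, hv'])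
  simpa using this

lemma wlen_letter_append (A : Adm m) {a : X} {ε : Bool} {v u : Word X}
    (hu : ∀ p ∈ u, p.2 = ε) (hvu : IsGeodesic (artinGen m) (v ++ u))
    (hv : wlen (artinGen m) (letterVal (artinGen m) (a, ε) * evalWord (artinGen m) v) = v.length + 1) :
    wlen (artinGen m) (letterVal (artinGen m) (a, ε) * evalWord (artinGen m) (v ++ u)) = (v ++ u).length + 1 := by
  induction u using List.reverseRecOn with
  | nil => simpa using hv
  | append_singleton u s ih =>
    rw [← List.append_assoc] at hvu ⊢
    have h1 := isGeodesic_left hvu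
    have h2 := ih (fun p hp => hu p (by simp [hp])) h1
    obtain ⟨b, c⟩ := s
    obtain rfl : c = ε := hu (b, c) (by simp)
    rw [isGeodesic_iff] at h1 hvu
    rw [evalWord_append _ (v ++ u), evalWord_singleton] at hvu ⊢
    rw [← mul_assoc, artin_extend A (v ++ u).length _ a b c h1.symm h2]
    · simp [add_assoc]
    · rw [← hvu]
      simp [add_assoc]

lemma preservedSignSuffixes (A : Adm m) (ε : Bool) : PreservedSignSuffixes ε (artinGen m) := by
  rintro w - hw - u ⟨⟨v, rfl⟩, -, hu, -⟩ a
  have hf := gradedGen_artinGen m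
  rcases wlen_letter_mul hf (a, ε) (evalWord (artinGen m) (v ++ u)) with h | h
  · refine ⟨(a, ε) :: (v ++ u), ?_, rfl, ⟨(a, ε) :: v, rfl⟩⟩
    rw [isGeodesic_iff] at hw ⊢
    rw [evalWord_cons, h, ← hw, List.length_cons]
  · have hv := isGeodesic_iff.1 (isGeodesic_left hw)
    have hw' := isGeodesic_iff.1 hw
    rcases wlen_letter_mul hf (a, ε) (evalWord (artinGen m) v) with h1 | h1
    · have := wlen_letter_append A hu hw (by rw [h1, ← hv])
      omega
    · obtain ⟨v', h2, h3⟩ := exists_geodesic hf (letterVal (artinGen m) (a, ε) *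
        evalWord (artinGen m) v)
      have h4 : evalWord (artinGen m) (v' ++ u) =
          letterVal (artinGen m) (a, ε) * evalWord (artinGen m) (v ++ u) := by
        rw [evalWord_append, h2, evalWord_append, mul_assoc]
      refine ⟨v' ++ u, ?_, by rw [h4, evalWord_cons], ⟨v', rfl⟩⟩
      rw [isGeodesic_iff, h4]
      rw [List.length_append] at hw' ⊢
      omega

end Group

end ThreeFreeArtin

/-- Every 3-free Artin group (no label equal to `3`) has preserved signed
suffixes. -/
theorem threeFree_preservedSignedSuffixes {X : Type*} [Fintype X] (m : X → X → ℕ∞)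
    (hsymm : ∀ x y : X, m x y = m y x) (hge2 : ∀ x y : X, x ≠ y → 2 ≤ m x y)
    (h3free : ∀ x y : X, x ≠ y → m x y ≠ 3) :
    PreservedSignedSuffixes (artinGen m) :=
  ⟨ThreeFreeArtin.preservedSignSuffixes ⟨hsymm, hge2, h3free⟩ true,
    ThreeFreeArtin.preservedSignSuffixes ⟨hsymm, hge2, h3free⟩ false⟩
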